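/- arXiv:1708.04827 — 7 statements merged into one kernel-verified Lean document; each statement's English description precedes it below -/
import Mathlib

section
/- Let m ≥ 1 be an integer and α > 0. Suppose h : ℝ × [0,∞) → ℝ is a smooth global-in-time solution of the area-preserving (AP) support-function flow, 2mπ-periodic in θ, with h + h_θθ > 0 everywhere. Then the initial data satisfy A(0) ≥ 0 and L(0)² ≥ 4mπ·A(0). Equivalently (Theorem 1.1(1)): if the initial locally convex closed curve has negative algebraic area A₀ < 0, or satisfies L₀² < 4mπ A₀, then the AP flow cannot exist for all time, i.e., a singularity occurs at some finite time. -/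
open Real MeasureTheory Filter

/-- Second derivative of the support function in the angle variable. -/
noncomputable def hpp (h : ℝ → ℝ → ℝ) (θ t : ℝ) : ℝ :=
  iteratedDeriv 2 (fun x => h x t) θ

/-- Length of the evolving curve: `L(t) = ∫₀^{2mπ} h dθ`. -/
noncomputable def len (m : ℕ) (h : ℝ → ℝ → ℝ) (t : ℝ) : ℝ :=
  ∫ θ in (0:ℝ)..(2 * m * π), h θ t

/-- Algebraic area: `A(t) = (1/2)∫₀^{2mπ} h (h + h_θθ) dθ`. -/
noncomputable def area (m : ℕ) (h : ℝ → ℝ → ℝ) (t : ℝ) : ℝ :=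
  (1 / 2) * ∫ θ in (0:ℝ)..(2 * m * π), h θ t * (h θ t + hpp h θ t)

/-- Nonlocal term of the area-preserving flow:
`λ(t) = (∫₀^{2mπ} (h + h_θθ)^{1-α} dθ) / (∫₀^{2mπ} h dθ)`. -/
noncomputable def lamAP (m : ℕ) (α : ℝ) (h : ℝ → ℝ → ℝ) (t : ℝ) : ℝ :=
  (∫ θ in (0:ℝ)..(2 * m * π), (h θ t + hpp h θ t) ^ (1 - α)) /
    (∫ θ in (0:ℝ)..(2 * m * π), h θ t)

lemma aux_dtheta (F : ℝ × ℝ → ℝ)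
    (hF : ContDiffOn ℝ (⊤ : ℕ∞) F (Set.univ ×ˢ Set.Ici (0:ℝ))) :
    ∃ G : ℝ × ℝ → ℝ, ContDiffOn ℝ (⊤ : ℕ∞) G (Set.univ ×ˢ Set.Ici (0:ℝ)) ∧
      ∀ θ t, 0 ≤ t → HasDerivAt (fun x => F (x, t)) (G (θ, t)) θ := by
  have hS : UniqueDiffOn ℝ ((Set.univ : Set ℝ) ×ˢ Set.Ici (0:ℝ)) :=
    uniqueDiffOn_univ.prod (uniqueDiffOn_Ici 0)
  refine ⟨fun p => fderivWithin ℝ F (Set.univ ×ˢ Set.Ici (0:ℝ)) p (1, 0), ?_, ?_⟩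
  · exact (hF.fderivWithin hS (by simp)).clm_apply contDiffOn_const
  · intro θ t ht
    have h1 := ((hF.differentiableOn (by simp)) (θ, t) ⟨trivial, ht⟩).hasFDerivWithinAt
    have h2 : HasDerivAt (fun x : ℝ => (x, t)) ((1:ℝ), (0:ℝ)) θ :=
      (hasDerivAt_id θ).prodMk (hasDerivAt_const θ t)
    refine h1.comp_hasDerivAt θ h2 ?_
    exact Eventually.of_forall fun x => ⟨trivial, ht⟩

lemma aux_dt (F : ℝ × ℝ → ℝ)
    (hF : ContDiffOn ℝ (⊤ : ℕ∞) F (Set.univ ×ˢ Set.Ici (0:ℝ))) :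
    ∃ G : ℝ × ℝ → ℝ, ContDiffOn ℝ (⊤ : ℕ∞) G (Set.univ ×ˢ Set.Ici (0:ℝ)) ∧
      ∀ θ t, 0 < t → HasDerivAt (fun x => F (θ, x)) (G (θ, t)) t := by
  have hS : UniqueDiffOn ℝ ((Set.univ : Set ℝ) ×ˢ Set.Ici (0:ℝ)) :=
    uniqueDiffOn_univ.prod (uniqueDiffOn_Ici 0)
  refine ⟨fun p => fderivWithin ℝ F (Set.univ ×ˢ Set.Ici (0:ℝ)) p (0, 1), ?_, ?_⟩
  · exact (hF.fderivWithin hS (by simp)).clm_apply contDiffOn_const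
  · intro θ t ht
    have h1 := ((hF.differentiableOn (by simp)) (θ, t) ⟨trivial, ht.le⟩).hasFDerivWithinAt
    have h2 : HasDerivAt (fun x : ℝ => (θ, x)) ((0:ℝ), (1:ℝ)) t :=
      (hasDerivAt_const t θ).prodMk (hasDerivAt_id t)
    refine h1.comp_hasDerivAt t h2 ?_
    filter_upwards [lt_mem_nhds ht] with x hx using ⟨trivial, hx.le⟩

lemma aux_slice (F : ℝ × ℝ → ℝ)
    (hF : ContinuousOn F (Set.univ ×ˢ Set.Ici (0:ℝ))) (t : ℝ) (ht : 0 ≤ t) :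
    Continuous (fun θ => F (θ, t)) :=
  hF.comp_continuous (by fun_prop) (fun x => ⟨trivial, ht⟩)

lemma aux_param_cont (F : ℝ × ℝ → ℝ) (P : ℝ)
    (hF : ContinuousOn F (Set.univ ×ˢ Set.Ici (0:ℝ))) :
    ContinuousOn (fun t => ∫ θ in (0:ℝ)..P, F (θ, t)) (Set.Ici 0) := by
  have h1 : Continuous (Function.uncurry fun t θ : ℝ => F (θ, max t 0)) :=
    hF.comp_continuous (f := fun p : ℝ × ℝ => (p.2, max p.1 0)) (by fun_prop)
      (fun x => ⟨trivial, Set.mem_Ici.2 (le_max_right _ _)⟩)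
  have h2 := intervalIntegral.continuous_parametric_intervalIntegral_of_continuous'
    (μ := volume) h1 0 P
  refine h2.continuousOn.congr ?_
  intro t ht
  simp only [max_eq_left (Set.mem_Ici.1 ht)]

lemma aux_param_deriv (F G : ℝ × ℝ → ℝ) (P : ℝ)
    (hF : ContinuousOn F (Set.univ ×ˢ Set.Ici (0:ℝ)))
    (hG : ContinuousOn G (Set.univ ×ˢ Set.Ici (0:ℝ)))
    (hFG : ∀ θ t, 0 < t → HasDerivAt (fun x => F (θ, x)) (G (θ, t)) t) (t : ℝ) (ht : 0 < t) :
    HasDerivAt (fun t => ∫ θ in (0:ℝ)..P, F (θ, t)) (∫ θ in (0:ℝ)..P, G (θ, t)) t := by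
  have hcomp : IsCompact ((Set.uIcc 0 P) ×ˢ (Set.Icc (t/2) (2*t))) :=
    isCompact_uIcc.prod isCompact_Icc
  obtain ⟨C, hC⟩ := hcomp.exists_bound_of_continuousOn (f := G)
    (hG.mono (fun p hp => ⟨trivial, le_trans (by positivity) hp.2.1⟩))
  refine (intervalIntegral.hasDerivAt_integral_of_dominated_loc_of_deriv_le
    (F := fun t θ => F (θ, t)) (F' := fun t θ => G (θ, t)) (bound := fun _ => C)
    (s := Set.Icc (t/2) (2*t)) (Icc_mem_nhds (by linarith) (by linarith)) ?_ ?_ ?_ ?_ ?_ ?_).2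
  · filter_upwards [lt_mem_nhds ht] with x hx
    exact (aux_slice F hF x hx.le).aestronglyMeasurable
  · exact (aux_slice F hF t ht.le).intervalIntegrable _ _
  · exact (aux_slice G hG t ht.le).aestronglyMeasurable
  · exact Eventually.of_forall fun θ hθ x hx => hC (θ, x) ⟨Set.uIoc_subset_uIcc hθ, hx⟩
  · exact intervalIntegrable_const
  · exact Eventually.of_forall fun θ hθ x hx => hFG θ x (by linarith [hx.1])

/-- tangent-line inequality for `x ↦ x^{-α}` -/
lemma aux_tangent (α a x : ℝ) (hα : 0 < α) (ha : 0 < a) (hx : 0 < x) :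
    α * a ^ (-α - 1) * (a - x) ≤ x ^ (-α) - a ^ (-α) := by
  have hy : 0 < x / a := div_pos hx ha
  have h1 : x ^ (-α) = (x / a) ^ (-α) * a ^ (-α) := by
    rw [← Real.mul_rpow hy.le ha.le, div_mul_cancel₀ _ ha.ne']
  have h2 : 1 - α * (x / a - 1) ≤ (x / a) ^ (-α) := by
    rw [Real.rpow_def_of_pos hy]
    have := Real.add_one_le_exp (Real.log (x / a) * -α)
    have := Real.log_le_sub_one_of_pos hy
    nlinarith
  have h3 : a ^ (-α - 1) = a ^ (-α) / a := by rw [Real.rpow_sub_one ha.ne']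
  have h4 : 0 < a ^ (-α) := Real.rpow_pos_of_pos ha _
  rw [h1, h3]
  have : α * (a ^ (-α) / a) * (a - x) = (1 - α * (x / a - 1) - 1) * a ^ (-α) := by
    field_simp; ring
  rw [this]
  nlinarith

lemma aux_pointwise (α a x : ℝ) (hα : 0 < α) (ha : 0 < a) (hx : 0 < x) :
    α * a ^ (-α - 1) * (max (a - x) 0) ^ 2 ≤ (x ^ (-α) - a ^ (-α)) * (a - x) := by
  rcases le_total x a with h | h
  · rw [max_eq_left (by linarith)]
    have := aux_tangent α a x hα ha hx
    nlinarith
  · rw [max_eq_right (by linarith)]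
    have : x ^ (-α) ≤ a ^ (-α) := Real.rpow_le_rpow_of_nonpos ha h (by linarith)
    nlinarith

lemma aux_cs (P : ℝ) (hP : 0 < P) (f : ℝ → ℝ) (hf : Continuous f) :
    (∫ θ in (0:ℝ)..P, f θ) ^ 2 ≤ P * ∫ θ in (0:ℝ)..P, f θ ^ 2 := by
  set I := ∫ θ in (0:ℝ)..P, f θ with hI
  have h0 : 0 ≤ ∫ θ in (0:ℝ)..P, (f θ - I / P) ^ 2 :=
    intervalIntegral.integral_nonneg hP.le (fun _ _ => sq_nonneg _)
  have h1 : ∫ θ in (0:ℝ)..P, (f θ - I / P) ^ 2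
      = (∫ θ in (0:ℝ)..P, f θ ^ 2) - (2 * I / P) * I + P * (I / P) ^ 2 := by
    have : ∀ θ, (f θ - I / P) ^ 2 = f θ ^ 2 - (2 * I / P) * f θ + (I / P) ^ 2 := by
      intro θ; ring
    simp only [this]
    rw [intervalIntegral.integral_add, intervalIntegral.integral_sub,
      intervalIntegral.integral_const_mul, intervalIntegral.integral_const, ← hI]
    · simp
    all_goals exact Continuous.intervalIntegrable (by fun_prop) _ _
  rw [h1] at h0
  have h2 : P * ((∫ θ in (0:ℝ)..P, f θ ^ 2) - (2 * I / P) * I + P * (I / P) ^ 2)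
     = P * (∫ θ in (0:ℝ)..P, f θ ^ 2) - I ^ 2 := by
    field_simp; ring
  nlinarith [mul_nonneg hP.le h0]

/-- `L¹` oscillation is controlled by the length dissipation. -/
lemma aux_dissip (P α : ℝ) (hP : 0 < P) (hα : 0 < α) (r : ℝ → ℝ) (hr : Continuous r)
    (hpos : ∀ θ, 0 < r θ) (a : ℝ) (ha : 0 < a) (hmean : ∫ θ in (0:ℝ)..P, r θ = P * a) :
    (∫ θ in (0:ℝ)..P, |r θ - a|) ^ 2 ≤ 4 * P * a ^ (α + 2) / α *
      ((∫ θ in (0:ℝ)..P, r θ ^ (-α)) - (∫ θ in (0:ℝ)..P, r θ ^ (1 - α)) / a) := by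
  have hc1 : Continuous (fun θ => r θ ^ (-α)) :=
    hr.rpow_const (fun θ => Or.inl (hpos θ).ne')
  have hc2 : Continuous (fun θ => r θ ^ (1 - α)) :=
    hr.rpow_const (fun θ => Or.inl (hpos θ).ne')
  have hw : ∫ θ in (0:ℝ)..P, |r θ - a| = 2 * ∫ θ in (0:ℝ)..P, max (a - r θ) 0 := by
    have : ∀ θ, |r θ - a| = 2 * max (a - r θ) 0 + (r θ - a) := by
      intro θ
      rcases le_total (r θ) a with h | h
      · rw [max_eq_left (by linarith), abs_of_nonpos (by linarith)]; ring
      · rw [max_eq_right (by linarith), abs_of_nonneg (by linarith)]; ring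
    simp only [this]
    rw [intervalIntegral.integral_add, intervalIntegral.integral_const_mul,
      intervalIntegral.integral_sub, hmean]
    · simp
    all_goals exact Continuous.intervalIntegrable (by fun_prop) _ _
  have hcs := aux_cs P hP (fun θ => max (a - r θ) 0) (by fun_prop)
  have hpt : ∫ θ in (0:ℝ)..P, α * a ^ (-α - 1) * (max (a - r θ) 0) ^ 2
      ≤ ∫ θ in (0:ℝ)..P, (r θ ^ (-α) - a ^ (-α)) * (a - r θ) := by
    refine intervalIntegral.integral_mono_on hP.le ?_ ?_
      (fun θ _ => aux_pointwise α a (r θ) hα ha (hpos θ))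
    all_goals exact Continuous.intervalIntegrable (by fun_prop) _ _
  have hex : ∫ θ in (0:ℝ)..P, (r θ ^ (-α) - a ^ (-α)) * (a - r θ)
      = a * (∫ θ in (0:ℝ)..P, r θ ^ (-α)) - (∫ θ in (0:ℝ)..P, r θ ^ (1 - α)) := by
    have : ∀ θ, (r θ ^ (-α) - a ^ (-α)) * (a - r θ)
        = (a * r θ ^ (-α) - r θ ^ (1 - α)) - a ^ (-α) * (a - r θ) := by
      intro θ
      have : r θ ^ (1 - α) = r θ ^ (-α) * r θ := by
        rw [← Real.rpow_add_one (hpos θ).ne']; congr 1; ring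
      rw [this]; ring
    simp only [this]
    rw [intervalIntegral.integral_sub, intervalIntegral.integral_sub,
      intervalIntegral.integral_const_mul, intervalIntegral.integral_const_mul,
      intervalIntegral.integral_sub, hmean]
    · simp
    all_goals exact Continuous.intervalIntegrable (by fun_prop) _ _
  rw [intervalIntegral.integral_const_mul, hex] at hpt
  rw [hw]
  set Q := ∫ θ in (0:ℝ)..P, (max (a - r θ) 0) ^ 2
  set I1 := ∫ θ in (0:ℝ)..P, r θ ^ (-α)
  set I2 := ∫ θ in (0:ℝ)..P, r θ ^ (1 - α)
  have hpow : a ^ (α + 2) * a ^ (-α - 1) = a := by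
    rw [← Real.rpow_add ha, show α + 2 + (-α - 1) = 1 by ring, Real.rpow_one]
  have hA : 0 < a ^ (α + 2) := Real.rpow_pos_of_pos ha _
  have hB : 0 < a ^ (-α - 1) := Real.rpow_pos_of_pos ha _
  have e1 : I1 - I2 / a = (a * I1 - I2) / a := by field_simp
  have e2 : 4 * P * Q = 4 * P * a ^ (α + 2) / α * ((α * a ^ (-α - 1) * Q) / a) := by
    have : 4 * P * a ^ (α + 2) / α * ((α * a ^ (-α - 1) * Q) / a)
        = 4 * P * Q * ((a ^ (α + 2) * a ^ (-α - 1)) / a) := by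
      field_simp
    rw [this, hpow, div_self ha.ne', mul_one]
  rw [e1]
  calc (2 * ∫ θ in (0:ℝ)..P, max (a - r θ) 0) ^ 2 ≤ 4 * P * Q := by nlinarith
    _ = _ := e2
    _ ≤ _ := by gcongr

/-- Isoperimetric-type deficit bound. -/
lemma aux_deficit (m : ℕ) (P : ℝ) (hPm : P = 2 * m * π) (hP : 0 < P) (h h1 h2 : ℝ → ℝ)
    (d1 : ∀ θ, HasDerivAt h (h1 θ) θ) (d2 : ∀ θ, HasDerivAt h1 (h2 θ) θ)
    (c2 : Continuous h2) (p0 : h P = h 0) (p1 : h1 P = h1 0) (a : ℝ)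
    (hmean : ∫ θ in (0:ℝ)..P, h θ = P * a) :
    |(∫ θ in (0:ℝ)..P, h θ * (h θ + h2 θ)) - P * a ^ 2|
      ≤ (∫ θ in (0:ℝ)..P, |h θ + h2 θ - a|) ^ 2 := by
  have c0 : Continuous h := continuous_iff_continuousAt.2 fun θ => (d1 θ).continuousAt
  have c1 : Continuous h1 := continuous_iff_continuousAt.2 fun θ => (d2 θ).continuousAt
  have hcosP : Real.cos P = 1 := by
    rw [hPm, show (2 * m * π : ℝ) = (m : ℝ) * (2 * π) by ring]; exact Real.cos_nat_mul_two_pi m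
  have hsinP : Real.sin P = 0 := by
    rw [hPm, show (2 * m * π : ℝ) = ((2 * m : ℕ) : ℝ) * π by push_cast; ring]
    exact Real.sin_nat_mul_pi _
  set w : ℝ → ℝ := fun θ => h θ + h2 θ - a with hw
  have cw : Continuous w := by fun_prop
  -- representation
  have rep : ∀ θ, ∫ s in (0:ℝ)..θ, w s * Real.sin (θ - s)
      = (h θ - a) - h1 0 * Real.sin θ - (h 0 - a) * Real.cos θ := by
    intro θ
    have hd : ∀ s ∈ Set.uIcc 0 θ, HasDerivAt
        (fun s => h1 s * Real.sin (θ - s) + (h s - a) * Real.cos (θ - s))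
        (w s * Real.sin (θ - s)) s := by
      intro s _
      have e : HasDerivAt (fun s => θ - s) (-1) s := by
        simpa using (hasDerivAt_id s).const_sub θ
      have := ((d2 s).mul e.sin).add (((d1 s).sub_const a).mul e.cos)
      refine this.congr_deriv ?_
      simp only [hw]; ring
    rw [intervalIntegral.integral_eq_sub_of_hasDerivAt hd
      (Continuous.intervalIntegrable (by fun_prop) _ _)]
    simp; ring
  have hmean2 : ∫ θ in (0:ℝ)..P, h2 θ = 0 := by
    rw [intervalIntegral.integral_eq_sub_of_hasDerivAt (fun s _ => d2 s)
      (c2.intervalIntegrable _ _), p1, sub_self]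
  have hwcos : ∫ θ in (0:ℝ)..P, w θ * Real.cos θ = 0 := by
    have hd : ∀ s ∈ Set.uIcc 0 P, HasDerivAt
        (fun s => h1 s * Real.cos s + (h s - a) * Real.sin s) (w s * Real.cos s) s := by
      intro s _
      have := ((d2 s).mul (Real.hasDerivAt_cos s)).add
        (((d1 s).sub_const a).mul (Real.hasDerivAt_sin s))
      refine this.congr_deriv ?_
      simp only [hw]; ring
    rw [intervalIntegral.integral_eq_sub_of_hasDerivAt hd
      (Continuous.intervalIntegrable (by fun_prop) _ _)]
    simp [hcosP, hsinP, p1]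
  have hwsin : ∫ θ in (0:ℝ)..P, w θ * Real.sin θ = 0 := by
    have hd : ∀ s ∈ Set.uIcc 0 P, HasDerivAt
        (fun s => h1 s * Real.sin s - (h s - a) * Real.cos s) (w s * Real.sin s) s := by
      intro s _
      have := ((d2 s).mul (Real.hasDerivAt_sin s)).sub
        (((d1 s).sub_const a).mul (Real.hasDerivAt_cos s))
      refine this.congr_deriv ?_
      simp only [hw]; ring
    rw [intervalIntegral.integral_eq_sub_of_hasDerivAt hd
      (Continuous.intervalIntegrable (by fun_prop) _ _)]
    simp [hcosP, hsinP, p0]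
  set u : ℝ → ℝ := fun θ => (h θ - a) - h1 0 * Real.sin θ - (h 0 - a) * Real.cos θ with hu
  have cu : Continuous u := by fun_prop
  set W := ∫ θ in (0:ℝ)..P, |w θ| with hW
  have hub : ∀ θ ∈ Set.Icc 0 P, |u θ| ≤ W := by
    intro θ hθ
    rw [hu]; simp only; rw [← rep θ]
    calc |∫ s in (0:ℝ)..θ, w s * Real.sin (θ - s)|
        ≤ ∫ s in (0:ℝ)..θ, |w s * Real.sin (θ - s)| :=
          intervalIntegral.abs_integral_le_integral_abs hθ.1
      _ ≤ ∫ s in (0:ℝ)..θ, |w s| := by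
          refine intervalIntegral.integral_mono_on hθ.1 ?_ ?_ ?_
          · exact Continuous.intervalIntegrable (by fun_prop) _ _
          · exact Continuous.intervalIntegrable (by fun_prop) _ _
          · intro s _
            rw [abs_mul]
            exact mul_le_of_le_one_right (abs_nonneg _) (Real.abs_sin_le_one _)
      _ ≤ W := by
          refine intervalIntegral.integral_mono_interval le_rfl hθ.1 hθ.2 ?_ ?_
          · exact Eventually.of_forall fun s => abs_nonneg _
          · exact Continuous.intervalIntegrable (by fun_prop) _ _
  have key : (∫ θ in (0:ℝ)..P, h θ * (h θ + h2 θ)) - P * a ^ 2 = ∫ θ in (0:ℝ)..P, u θ * w θ := by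
    have : ∀ θ, u θ * w θ = h θ * (h θ + h2 θ) - a * h θ - a * h θ - a * h2 θ + a ^ 2
        - h1 0 * (w θ * Real.sin θ) - (h 0 - a) * (w θ * Real.cos θ) := by
      intro θ; simp only [hu, hw]; ring
    simp only [this]
    rw [intervalIntegral.integral_sub, intervalIntegral.integral_sub, intervalIntegral.integral_add,
      intervalIntegral.integral_sub, intervalIntegral.integral_sub, intervalIntegral.integral_sub,
      intervalIntegral.integral_const_mul, intervalIntegral.integral_const_mul,
      intervalIntegral.integral_const_mul, intervalIntegral.integral_const_mul, hwsin, hwcos,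
      hmean, hmean2]
    · simp; ring
    all_goals exact Continuous.intervalIntegrable (by fun_prop) _ _
  rw [key]
  calc |∫ θ in (0:ℝ)..P, u θ * w θ| ≤ ∫ θ in (0:ℝ)..P, |u θ * w θ| :=
        intervalIntegral.abs_integral_le_integral_abs hP.le
    _ ≤ ∫ θ in (0:ℝ)..P, W * |w θ| := by
        refine intervalIntegral.integral_mono_on hP.le ?_ ?_ ?_
        · exact Continuous.intervalIntegrable (by fun_prop) _ _
        · exact Continuous.intervalIntegrable (by fun_prop) _ _
        · intro s hs
          rw [abs_mul]
          exact mul_le_mul_of_nonneg_right (hub s hs) (abs_nonneg _)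
    _ = W ^ 2 := by rw [intervalIntegral.integral_const_mul, ← hW, sq]

/-- Self-adjointness of the map sending h to h plus its second derivative, on periodic functions. -/
lemma aux_selfadj (P : ℝ) (f f1 f2 g g1 g2 : ℝ → ℝ)
    (df : ∀ θ, HasDerivAt f (f1 θ) θ) (df1 : ∀ θ, HasDerivAt f1 (f2 θ) θ) (cf : Continuous f2)
    (dg : ∀ θ, HasDerivAt g (g1 θ) θ) (dg1 : ∀ θ, HasDerivAt g1 (g2 θ) θ) (cg : Continuous g2)
    (pf : f P = f 0) (pf1 : f1 P = f1 0) (pg : g P = g 0) (pg1 : g1 P = g1 0) :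
    ∫ θ in (0:ℝ)..P, (f θ * (g θ + g2 θ) - g θ * (f θ + f2 θ)) = 0 := by
  have c0 : Continuous f := continuous_iff_continuousAt.2 fun θ => (df θ).continuousAt
  have c1 : Continuous g := continuous_iff_continuousAt.2 fun θ => (dg θ).continuousAt
  have hd : ∀ s ∈ Set.uIcc 0 P, HasDerivAt (fun s => f s * g1 s - g s * f1 s)
      (f s * (g s + g2 s) - g s * (f s + f2 s)) s := by
    intro s _
    refine (((df s).mul (dg1 s)).sub ((dg s).mul (df1 s))).congr_deriv ?_
    ring
  rw [intervalIntegral.integral_eq_sub_of_hasDerivAt hd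
      (Continuous.intervalIntegrable (by fun_prop) _ _)]
  simp [pf, pf1, pg, pg1]

/-- If the AP support-function flow has a smooth global-in-time solution, then the
initial data satisfy `A(0) ≥ 0` and `L(0)² ≥ 4mπ A(0)`. -/
theorem ap_global_implies_area_nonneg_and_isoperimetric
    (m : ℕ) (hm : 1 ≤ m) (α : ℝ) (hα : 0 < α) (h : ℝ → ℝ → ℝ)
    (hsmooth : ContDiffOn ℝ (⊤ : ℕ∞) (Function.uncurry h) (Set.univ ×ˢ Set.Ici (0:ℝ)))
    (hper : ∀ θ t, 0 ≤ t → h (θ + 2 * m * π) t = h θ t)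
    (hconv : ∀ θ t, 0 ≤ t → 0 < h θ t + hpp h θ t)
    (hflow : ∀ θ t, 0 ≤ t →
      derivWithin (fun s => h θ s) (Set.Ici 0) t
        = -(h θ t + hpp h θ t) ^ (-α) + lamAP m α h t) :
    0 ≤ area m h 0 ∧ 4 * m * π * area m h 0 ≤ (len m h 0) ^ 2 := by
  set P : ℝ := 2 * m * π with hPdef
  have hP : 0 < P := by
    have : (1:ℝ) ≤ m := by exact_mod_cast hm
    have := Real.pi_pos
    positivity
  set F : ℝ × ℝ → ℝ := Function.uncurry h with hF
  have hFh : ∀ θ t, h θ t = F (θ, t) := fun _ _ => rfl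
  obtain ⟨F1, sF1, dF⟩ := aux_dtheta F hsmooth
  obtain ⟨F2, sF2, dF1⟩ := aux_dtheta F1 sF1
  obtain ⟨Ft, sFt, dFt⟩ := aux_dt F hsmooth
  obtain ⟨R, hR⟩ : ∃ R : ℝ × ℝ → ℝ, R = fun p => F p + F2 p := ⟨_, rfl⟩
  have sR : ContDiffOn ℝ (⊤ : ℕ∞) R (Set.univ ×ˢ Set.Ici (0:ℝ)) := by
    rw [hR]; exact hsmooth.add sF2
  have hRe : ∀ p, R p = F p + F2 p := fun p => by rw [hR]
  obtain ⟨Rt, sRt, dRt⟩ := aux_dt R sR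
  have cF := hsmooth.continuousOn
  have cF2 := sF2.continuousOn
  have cR := sR.continuousOn
  have hpp_eq : ∀ θ t, 0 ≤ t → hpp h θ t = F2 (θ, t) := by
    intro θ t ht
    have e1 : deriv (fun x => h x t) = fun x => F1 (x, t) := by
      funext x; exact (dF x t ht).deriv
    rw [hpp, iteratedDeriv_succ, iteratedDeriv_one, e1]
    exact (dF1 θ t ht).deriv
  have hRh : ∀ θ t, 0 ≤ t → h θ t + hpp h θ t = R (θ, t) := by
    intro θ t ht; rw [hpp_eq θ t ht, hRe, hFh]
  have hRpos : ∀ θ t, 0 ≤ t → 0 < R (θ, t) := fun θ t ht => hRh θ t ht ▸ hconv θ t ht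
  have hper0 : ∀ t, 0 ≤ t → F (P, t) = F (0, t) := by
    intro t ht
    have := hper 0 t ht
    rwa [zero_add] at this
  have hper1 : ∀ t, 0 ≤ t → F1 (P, t) = F1 (0, t) := by
    intro t ht
    have e1 : HasDerivAt (fun x => F (x + P, t)) (F1 (0 + P, t)) 0 :=
      (dF (0 + P) t ht).comp_add_const 0 P
    have e2 : (fun x => F (x + P, t)) = fun x => F (x, t) := by
      funext x; exact hper x t ht
    rw [e2, zero_add] at e1
    exact e1.unique (dF 0 t ht)
  have slF := aux_slice F cF
  have slF2 := aux_slice F2 cF2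
  have slR := aux_slice R cR
  obtain ⟨L, hL⟩ : ∃ L : ℝ → ℝ, L = fun t => ∫ θ in (0:ℝ)..P, F (θ, t) := ⟨_, rfl⟩
  obtain ⟨B, hB⟩ : ∃ B : ℝ → ℝ, B = fun t => ∫ θ in (0:ℝ)..P, F (θ, t) * R (θ, t) := ⟨_, rfl⟩
  have hLe : ∀ t, ∫ θ in (0:ℝ)..P, F (θ, t) = L t := fun t => by rw [hL]
  have hBe : ∀ t, ∫ θ in (0:ℝ)..P, F (θ, t) * R (θ, t) = B t := fun t => by rw [hB]
  have hLR : ∀ t, 0 ≤ t → ∫ θ in (0:ℝ)..P, R (θ, t) = L t := by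
    intro t ht
    simp only [hRe]
    rw [intervalIntegral.integral_add ((slF t ht).intervalIntegrable _ _)
      ((slF2 t ht).intervalIntegrable _ _), hLe,
      intervalIntegral.integral_eq_sub_of_hasDerivAt (fun s _ => dF1 s t ht)
      ((slF2 t ht).intervalIntegrable _ _), hper1 t ht, sub_self, add_zero]
  have hLpos : ∀ t, 0 ≤ t → 0 < L t := by
    intro t ht
    rw [← hLR t ht]
    exact intervalIntegral.intervalIntegral_pos_of_pos ((slR t ht).intervalIntegrable _ _)
      (fun θ => hRpos θ t ht) hP
  obtain ⟨I1, hI1⟩ : ∃ I : ℝ → ℝ, I = fun t => ∫ θ in (0:ℝ)..P, R (θ, t) ^ (-α) := ⟨_, rfl⟩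
  obtain ⟨I2, hI2⟩ : ∃ I : ℝ → ℝ, I = fun t => ∫ θ in (0:ℝ)..P, R (θ, t) ^ (1 - α) := ⟨_, rfl⟩
  have hI1e : ∀ t, ∫ θ in (0:ℝ)..P, R (θ, t) ^ (-α) = I1 t := fun t => by rw [hI1]
  have hI2e : ∀ t, ∫ θ in (0:ℝ)..P, R (θ, t) ^ (1 - α) = I2 t := fun t => by rw [hI2]
  have slp : ∀ t, 0 ≤ t → ∀ q : ℝ, Continuous (fun θ => R (θ, t) ^ q) := fun t ht q =>
    (slR t ht).rpow_const (fun θ => Or.inl (hRpos θ t ht).ne')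
  have hlam : ∀ t, 0 ≤ t → lamAP m α h t = I2 t / L t := by
    intro t ht
    have : ∀ θ, h θ t + hpp h θ t = R (θ, t) := fun θ => hRh θ t ht
    rw [lamAP]
    simp only [this]
    rw [← hPdef, hI2e, ← hLe]
    rfl
  have hFt : ∀ θ t, 0 < t → Ft (θ, t) = -R (θ, t) ^ (-α) + I2 t / L t := by
    intro θ t ht
    have e := hflow θ t ht.le
    rw [derivWithin_of_mem_nhds (Ici_mem_nhds ht), hRh θ t ht.le, hlam t ht.le] at e
    rw [← e]
    exact (dFt θ t ht).deriv.symm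
  -- derivative of the length
  have hLd : ∀ t, 0 < t → HasDerivAt L (-(I1 t - I2 t / (L t / P))) t := by
    intro t ht
    have e := aux_param_deriv F Ft P cF sFt.continuousOn dFt t ht
    rw [← hL] at e
    refine e.congr_deriv ?_
    simp only [hFt _ t ht]
    rw [intervalIntegral.integral_add (((slp t ht.le (-α)).fun_neg).intervalIntegrable _ _)
      intervalIntegrable_const, intervalIntegral.integral_neg, hI1e,
      intervalIntegral.integral_const]
    have := (hLpos t ht.le).ne'
    simp only [smul_eq_mul, sub_zero]
    field_simp
    ring
  -- derivative of the area
  have hBd : ∀ t, 0 < t → HasDerivAt B 0 t := by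
    intro s hs
    have cfs : ∀ Q : ℝ × ℝ → ℝ, ContinuousOn Q (Set.univ ×ˢ Set.Ici (0:ℝ)) →
        ContinuousOn (fun p : ℝ × ℝ => Q (p.1, s)) (Set.univ ×ˢ Set.Ici (0:ℝ)) := by
      intro Q hQ
      exact ((aux_slice Q hQ s hs.le).comp continuous_fst).continuousOn
    have e := aux_param_deriv (fun p => (F p - F (p.1, s)) * (R p + R (p.1, s)))
      (fun p => Ft p * (R p + R (p.1, s)) + (F p - F (p.1, s)) * Rt p) P
      ((cF.sub (cfs F cF)).mul (cR.add (cfs R cR)))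
      ((sFt.continuousOn.mul (cR.add (cfs R cR))).add ((cF.sub (cfs F cF)).mul sRt.continuousOn))
      (fun θ t ht => ((dFt θ t ht).sub_const (F (θ, s))).mul
        ((dRt θ t ht).add_const (R (θ, s)))) s hs
    have v : ∫ θ in (0:ℝ)..P, (Ft (θ, s) * (R (θ, s) + R (θ, s))
        + (F (θ, s) - F (θ, s)) * Rt (θ, s)) = 0 := by
      have : ∀ θ, Ft (θ, s) * (R (θ, s) + R (θ, s)) + (F (θ, s) - F (θ, s)) * Rt (θ, s)
          = 2 * ((I2 s / L s) * R (θ, s) - R (θ, s) ^ (1 - α)) := by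
        intro θ
        have e1 : R (θ, s) ^ (1 - α) = R (θ, s) ^ (-α) * R (θ, s) := by
          rw [← Real.rpow_add_one (hRpos θ s hs.le).ne']; congr 1; ring
        rw [hFt θ s hs, e1]; ring
      simp only [this]
      rw [intervalIntegral.integral_const_mul, intervalIntegral.integral_sub
        (((slR s hs.le).const_mul _).intervalIntegrable _ _)
        ((slp s hs.le _).intervalIntegrable _ _), intervalIntegral.integral_const_mul,
        hLR s hs.le, hI2e, div_mul_cancel₀ _ (hLpos s hs.le).ne']
      simp
    have e' := (e.congr_deriv v).add_const (B s)
    refine e'.congr_of_eventuallyEq ?_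
    filter_upwards [lt_mem_nhds hs] with t ht
    have sa := aux_selfadj P (fun θ => F (θ, t)) (fun θ => F1 (θ, t)) (fun θ => F2 (θ, t))
      (fun θ => F (θ, s)) (fun θ => F1 (θ, s)) (fun θ => F2 (θ, s))
      (fun θ => dF θ t ht.le) (fun θ => dF1 θ t ht.le) (slF2 t ht.le)
      (fun θ => dF θ s hs.le) (fun θ => dF1 θ s hs.le) (slF2 s hs.le)
      (hper0 t ht.le) (hper1 t ht.le) (hper0 s hs.le) (hper1 s hs.le)
    simp only [← hRe] at sa
    have c1 := slF t ht.le
    have c2 := slF s hs.le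
    have c3 := slR t ht.le
    have c4 := slR s hs.le
    have : ∀ θ, (F (θ, t) - F (θ, s)) * (R (θ, t) + R (θ, s))
        = (F (θ, t) * R (θ, t) - F (θ, s) * R (θ, s))
          + (F (θ, t) * R (θ, s) - F (θ, s) * R (θ, t)) := by intro θ; ring
    simp only [this]
    rw [intervalIntegral.integral_add, sa, intervalIntegral.integral_sub, hBe, hBe]
    · ring
    · exact (c1.mul c3).intervalIntegrable _ _
    · exact (c2.mul c4).intervalIntegrable _ _
    · exact ((c1.mul c3).sub (c2.mul c4)).intervalIntegrable _ _
    · exact ((c1.mul c4).sub (c2.mul c3)).intervalIntegrable _ _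
  have hLc : ContinuousOn L (Set.Ici 0) := by
    rw [hL]; exact aux_param_cont F P cF
  have hBc : ContinuousOn B (Set.Ici 0) := by
    rw [hB]; exact aux_param_cont (fun p => F p * R p) P (cF.mul cR)
  have hBconst : ∀ t, 0 ≤ t → B t = B 0 := by
    intro t ht
    have hdiff : DifferentiableOn ℝ B (interior (Set.Ici 0)) := by
      rw [interior_Ici]
      exact fun x hx => (hBd x hx).differentiableAt.differentiableWithinAt
    apply le_antisymm
    · refine antitoneOn_of_deriv_nonpos (convex_Ici 0) hBc hdiff ?_ Set.self_mem_Ici ht ht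
      rw [interior_Ici]
      exact fun x hx => (hBd x hx).deriv.le
    · refine monotoneOn_of_deriv_nonneg (convex_Ici 0) hBc hdiff ?_ Set.self_mem_Ici ht ht
      rw [interior_Ici]
      exact fun x hx => (hBd x hx).deriv.ge
  -- the main estimate
  have hmain : ∀ t, 0 ≤ t → |B t - L t ^ 2 / P|
      ≤ 4 * P * (L t / P) ^ (α + 2) / α * (I1 t - I2 t / (L t / P)) := by
    intro t ht
    have ha : 0 < L t / P := div_pos (hLpos t ht) hP
    have hm1 : L t = P * (L t / P) := by field_simp
    have e1 := aux_dissip P α hP hα (fun θ => R (θ, t)) (slR t ht) (fun θ => hRpos θ t ht)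
      (L t / P) ha ((hLR t ht).trans hm1)
    have e2 := aux_deficit m P hPdef hP (fun θ => F (θ, t)) (fun θ => F1 (θ, t))
      (fun θ => F2 (θ, t)) (fun θ => dF θ t ht) (fun θ => dF1 θ t ht) (slF2 t ht)
      (hper0 t ht) (hper1 t ht) (L t / P) ((hLe t).trans hm1)
    simp only [← hRe] at e2
    rw [hBe, show P * (L t / P) ^ 2 = L t ^ 2 / P by field_simp] at e2
    simp only [hI1e, hI2e] at e1
    exact e2.trans e1
  have hDnn : ∀ t, 0 ≤ t → 0 ≤ I1 t - I2 t / (L t / P) := by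
    intro t ht
    have ha : 0 < L t / P := div_pos (hLpos t ht) hP
    have hc : 0 < 4 * P * (L t / P) ^ (α + 2) / α := by
      have := Real.rpow_pos_of_pos ha (α + 2)
      positivity
    exact nonneg_of_mul_nonneg_right ((abs_nonneg _).trans (hmain t ht)) hc
  have hLdiff : DifferentiableOn ℝ L (interior (Set.Ici 0)) := by
    rw [interior_Ici]
    exact fun x hx => (hLd x hx).differentiableAt.differentiableWithinAt
  have hLanti : AntitoneOn L (Set.Ici 0) := by
    refine antitoneOn_of_deriv_nonpos (convex_Ici 0) hLc hLdiff ?_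
    rw [interior_Ici]
    intro x hx
    rw [(hLd x hx).deriv]
    linarith [hDnn x (le_of_lt hx)]
  -- uniform constant
  obtain ⟨C, hC⟩ : ∃ C : ℝ, C = 4 * P * (L 0 / P) ^ (α + 2) / α := ⟨_, rfl⟩
  have hCpos : 0 < C := by
    have := Real.rpow_pos_of_pos (div_pos (hLpos 0 le_rfl) hP) (α + 2)
    rw [hC]; positivity
  have hest : ∀ t, 0 ≤ t → |B 0 - L t ^ 2 / P| ≤ C * (I1 t - I2 t / (L t / P)) := by
    intro t ht
    have h1 := hmain t ht
    rw [hBconst t ht] at h1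
    refine h1.trans (mul_le_mul_of_nonneg_right ?_ (hDnn t ht))
    rw [hC]
    have ha : 0 < L t / P := div_pos (hLpos t ht) hP
    have hle : L t ≤ L 0 := hLanti Set.self_mem_Ici ht ht
    gcongr
  -- no uniform gap is possible
  have hnogap : ∀ δ : ℝ, 0 < δ → ¬ ∀ t, 0 ≤ t → δ ≤ |B 0 - L t ^ 2 / P| := by
    intro δ hδ hall
    have hT : 0 ≤ L 0 / (δ / C) := by have := hLpos 0 le_rfl; positivity
    have := (convex_Ici (0:ℝ)).image_sub_le_mul_sub_of_deriv_le hLc hLdiff (C := -(δ / C)) ?_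
      0 Set.self_mem_Ici (L 0 / (δ / C)) hT hT
    · have h2 := hLpos _ hT
      rw [sub_zero, neg_mul, mul_div_cancel₀ _ (by positivity)] at this
      linarith
    · rw [interior_Ici]
      intro x hx
      have hx' : 0 ≤ x := le_of_lt hx
      rw [(hLd x hx).deriv, neg_le_neg_iff, div_le_iff₀ hCpos, mul_comm]
      exact (hall x hx').trans (hest x hx')
  have hareaB : area m h 0 = 1 / 2 * B 0 := by
    have : ∀ θ, h θ 0 + hpp h θ 0 = R (θ, 0) := fun θ => hRh θ 0 le_rfl
    rw [area]
    simp only [this]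
    rw [← hBe]
    rfl
  have hlenL : len m h 0 = L 0 := by rw [← hLe]; rfl
  rw [hareaB, hlenL]
  constructor
  · by_contra hneg
    refine hnogap (-B 0) (by linarith) (fun t ht => ?_)
    have : 0 ≤ L t ^ 2 / P := by positivity
    rw [abs_of_nonpos (by linarith)]
    linarith
  · by_contra hneg
    have h1 : L 0 ^ 2 / P < B 0 := by
      rw [div_lt_iff₀ hP]
      rw [not_le] at hneg
      have : (4 * m * π * (1 / 2 * B 0) : ℝ) = B 0 * P := by rw [hPdef]; ring
      linarith
    refine hnogap (B 0 - L 0 ^ 2 / P) (by linarith) (fun t ht => ?_)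
    refine le_trans ?_ (le_abs_self _)
    have h2 := hLpos t ht
    have hle : L t ≤ L 0 := hLanti Set.self_mem_Ici ht ht
    gcongr
end

section
/- Let m ≥ 1 be an integer, α > 0, and let h : ℝ × [0,T) → ℝ be a smooth solution of the area-preserving (AP) support-function flow, 2mπ-periodic in θ, with h + h_θθ > 0 everywhere. Then the length L(t) = ∫₀^{2mπ} h(θ,t) dθ is nonincreasing in t. -/
open Real MeasureTheory Filter

/-- Chebyshev-type inequality for `ρ` and `ρ ^ (-α)`. -/
lemma cheb_aux (P α : ℝ) (hP : 0 < P) (hα : 0 < α) (r : ℝ → ℝ) (hc : Continuous r)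
    (hr : ∀ x, 0 < r x) :
    P * ((∫ x in (0:ℝ)..P, r x ^ (1 - α)) / (∫ x in (0:ℝ)..P, r x))
      ≤ ∫ x in (0:ℝ)..P, r x ^ (-α) := by
  have hI : 0 < ∫ x in (0:ℝ)..P, r x :=
    intervalIntegral.intervalIntegral_pos_of_pos (hc.intervalIntegrable _ _) hr hP
  set I := ∫ x in (0:ℝ)..P, r x with hIdef
  set c := I / P with hcdef
  have hcpos : 0 < c := div_pos hI hP
  have hc1 : Continuous fun x => r x ^ (1 - α) :=
    hc.rpow_const fun x => Or.inl (hr x).ne'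
  have hc2 : Continuous fun x => r x ^ (-α) :=
    hc.rpow_const fun x => Or.inl (hr x).ne'
  have key : ∀ x, r x ^ (1 - α) ≤ c * r x ^ (-α) + c ^ (-α) * (r x - c) := by
    intro x
    have e : r x ^ (1 - α) = r x * r x ^ (-α) := by
      rw [sub_eq_add_neg, Real.rpow_add (hr x), Real.rpow_one]
    rw [e]
    rcases le_total (r x) c with hle | hle
    · have := Real.rpow_le_rpow_of_nonpos (hr x) hle (neg_nonpos.2 hα.le)
      nlinarith
    · have := Real.rpow_le_rpow_of_nonpos hcpos hle (neg_nonpos.2 hα.le)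
      nlinarith
  have hint := intervalIntegral.integral_mono (μ := volume) hP.le (hc1.intervalIntegrable 0 P)
    (Continuous.intervalIntegrable (by fun_prop) 0 P) key
  have e2 : ∫ x in (0:ℝ)..P, (c * r x ^ (-α) + c ^ (-α) * (r x - c))
      = c * ∫ x in (0:ℝ)..P, r x ^ (-α) := by
    rw [intervalIntegral.integral_add
      (Continuous.intervalIntegrable (by fun_prop) 0 P)
      (Continuous.intervalIntegrable (by fun_prop) 0 P),
      intervalIntegral.integral_const_mul, intervalIntegral.integral_const_mul,
      intervalIntegral.integral_sub (hc.intervalIntegrable 0 P)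
      (Continuous.intervalIntegrable (by fun_prop) 0 P), ← hIdef]
    simp [hcdef]
    right
    field_simp
    ring
  rw [e2] at hint
  have : P * ((∫ x in (0:ℝ)..P, r x ^ (1 - α)) / I) = (∫ x in (0:ℝ)..P, r x ^ (1 - α)) / c := by
    rw [hcdef]; field_simp
  rw [this, div_le_iff₀ hcpos]
  linarith

/-- Integral of the second derivative of a periodic function over a period. -/
lemma int_deriv2_aux (P : ℝ) (f : ℝ → ℝ) (hf : ContDiff ℝ 2 f) (hp : ∀ x, f (x + P) = f x) :
    ∫ x in (0:ℝ)..P, iteratedDeriv 2 f x = 0 := by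
  have e : iteratedDeriv 2 f = deriv (deriv f) := by
    rw [iteratedDeriv_succ, iteratedDeriv_one]
  have hd : ContDiff ℝ 1 (deriv f) := hf.deriv' (n := 1)
  rw [e, intervalIntegral.integral_deriv_eq_sub
    (fun x _ => (hd.differentiable (by norm_num)) x)
    ((hd.continuous_deriv (by norm_num)).intervalIntegrable _ _)]
  have : deriv f (0 + P) = deriv f 0 := by
    rw [← deriv_comp_add_const]
    congr 1
    funext x
    exact hp x
  rw [zero_add] at this
  rw [this, sub_self]

/-- Along the AP support-function flow on `[0,T)`, the length `L(t)` is nonincreasing. -/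
theorem ap_flow_length_nonincreasing
    (m : ℕ) (hm : 1 ≤ m) (α T : ℝ) (hα : 0 < α) (hT : 0 < T) (h : ℝ → ℝ → ℝ)
    (hsmooth : ContDiffOn ℝ (⊤ : ℕ∞) (Function.uncurry h) (Set.univ ×ˢ Set.Ico (0:ℝ) T))
    (hper : ∀ θ, ∀ t ∈ Set.Ico (0:ℝ) T, h (θ + 2 * m * π) t = h θ t)
    (hconv : ∀ θ, ∀ t ∈ Set.Ico (0:ℝ) T, 0 < h θ t + hpp h θ t)
    (hflow : ∀ θ, ∀ t ∈ Set.Ico (0:ℝ) T,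
      derivWithin (fun s => h θ s) (Set.Ico 0 T) t
        = -(h θ t + hpp h θ t) ^ (-α) + lamAP m α h t) :
    AntitoneOn (len m h) (Set.Ico 0 T) := by
  set P : ℝ := 2 * m * π with hPdef
  have hP : 0 < P := by
    have : (0:ℝ) < m := by exact_mod_cast hm
    positivity
  have hslice : ∀ t ∈ Set.Ico (0:ℝ) T, ContDiff ℝ (⊤ : ℕ∞) (fun x => h x t) := by
    intro t ht
    rw [← contDiffOn_univ]
    exact hsmooth.comp (f := fun x : ℝ => (x, t)) (by fun_prop) (fun x _ => ⟨trivial, ht⟩)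
  have hcontL : ContinuousOn (len m h) (Set.Ico 0 T) := by
    rw [continuousOn_iff_continuous_domRestrict]
    have : Continuous (Function.uncurry fun (t : Set.Ico (0:ℝ) T) (x : ℝ) => h x t) := by
      have := hsmooth.continuousOn.comp_continuous
        (f := fun q : Set.Ico (0:ℝ) T × ℝ => (q.2, (q.1 : ℝ))) (by fun_prop)
        (fun q => ⟨trivial, q.1.2⟩)
      exact this
    exact intervalIntegral.continuous_parametric_intervalIntegral_of_continuous'
      (μ := volume) this 0 P
  have hopen : IsOpen ((Set.univ : Set ℝ) ×ˢ Set.Ioo (0:ℝ) T) := isOpen_univ.prod isOpen_Ioo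
  have hsm : ContDiffOn ℝ (⊤ : ℕ∞) (Function.uncurry h) (Set.univ ×ˢ Set.Ioo (0:ℝ) T) :=
    hsmooth.mono (Set.prod_mono le_rfl Set.Ioo_subset_Ico_self)
  have hfd : ContinuousOn (fun q => fderiv ℝ (Function.uncurry h) q ((0:ℝ), (1:ℝ)))
      (Set.univ ×ˢ Set.Ioo (0:ℝ) T) :=
    (hsm.continuousOn_fderiv_of_isOpen hopen (by norm_num)).clm_apply continuousOn_const
  have hder : ∀ x, ∀ t ∈ Set.Ioo (0:ℝ) T,
      HasDerivAt (fun s => h x s) (fderiv ℝ (Function.uncurry h) (x, t) ((0:ℝ), (1:ℝ))) t := by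
    intro x t ht
    have h1 : HasFDerivAt (Function.uncurry h) (fderiv ℝ (Function.uncurry h) (x, t)) (x, t) :=
      ((hsm.differentiableOn (by norm_num)).differentiableAt
        (hopen.mem_nhds ⟨trivial, ht⟩)).hasFDerivAt
    exact h1.comp_hasDerivAt t ((hasDerivAt_const t x).prodMk (hasDerivAt_id t))
  have hLder : ∀ t ∈ Set.Ioo (0:ℝ) T, HasDerivAt (len m h)
      (∫ x in (0:ℝ)..P, fderiv ℝ (Function.uncurry h) (x, t) ((0:ℝ), (1:ℝ))) t := by
    intro t ht
    obtain ⟨a, hat, b, hb⟩ : ∃ a < t, ∃ b > t, Set.Icc a b ⊆ Set.Ioo 0 T := by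
      refine ⟨t / 2, by linarith [ht.1], (t + T) / 2, by linarith [ht.2], ?_⟩
      intro s hs
      exact ⟨by linarith [hs.1, ht.1], by linarith [hs.2, ht.2]⟩
    obtain ⟨hbt, hb⟩ := hb
    obtain ⟨C, hC⟩ := ((isCompact_Icc (a := (0:ℝ)) (b := P)).prod
      (isCompact_Icc (a := a) (b := b))).exists_bound_of_continuousOn
      (hfd.mono (Set.prod_mono (Set.subset_univ _) hb))
    have hmeas : Continuous fun x => fderiv ℝ (Function.uncurry h) (x, t) ((0:ℝ), (1:ℝ)) :=
      hfd.comp_continuous (f := fun x : ℝ => (x, t)) (by fun_prop) (fun x => ⟨trivial, ht⟩)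
    refine (intervalIntegral.hasDerivAt_integral_of_dominated_loc_of_deriv_le
      (F := fun s x => h x s)
      (F' := fun s x => fderiv ℝ (Function.uncurry h) (x, s) ((0:ℝ), (1:ℝ)))
      (bound := fun _ => C) (s := Set.Icc a b) (Icc_mem_nhds hat hbt) ?_ ?_ ?_ ?_ ?_ ?_).2
    · filter_upwards [Icc_mem_nhds hat hbt] with s hs
      exact (hslice s (Set.Ioo_subset_Ico_self (hb hs))).continuous.aestronglyMeasurable
    · exact (hslice t (Set.Ioo_subset_Ico_self ht)).continuous.intervalIntegrable _ _
    · exact hmeas.aestronglyMeasurable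
    · refine Eventually.of_forall fun x hx s hs => hC (x, s) ⟨?_, hs⟩
      rw [Set.uIoc_of_le hP.le] at hx
      exact Set.Ioc_subset_Icc_self hx
    · exact continuous_const.intervalIntegrable _ _
    · exact Eventually.of_forall fun x hx s hs => hder x s (hb hs)
  refine antitoneOn_of_deriv_nonpos (convex_Ico 0 T) hcontL ?_ ?_
  · rw [interior_Ico]
    exact fun t ht => (hLder t ht).differentiableAt.differentiableWithinAt
  · rw [interior_Ico]
    intro t ht
    have ht' := Set.Ioo_subset_Ico_self ht
    rw [(hLder t ht).deriv]
    have hs := hslice t ht'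
    have hs2 : ContDiff ℝ 2 (fun x => h x t) := contDiff_infty.1 hs 2
    have hppc : Continuous (fun x => hpp h x t) := hs2.continuous_iteratedDeriv 2 le_rfl
    have hrc : Continuous (fun x => h x t + hpp h x t) := hs.continuous.add hppc
    have hrp : ∀ x, 0 < h x t + hpp h x t := fun x => hconv x t ht'
    have heq : ∀ x, fderiv ℝ (Function.uncurry h) (x, t) ((0:ℝ), (1:ℝ))
        = -(h x t + hpp h x t) ^ (-α) + lamAP m α h t := by
      intro x
      rw [← hflow x t ht', derivWithin_of_mem_nhds (Ico_mem_nhds ht.1 ht.2)]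
      exact (hder x t ht).deriv.symm
    have hL : ∫ x in (0:ℝ)..P, (h x t + hpp h x t) = ∫ x in (0:ℝ)..P, h x t := by
      rw [intervalIntegral.integral_add (hs.continuous.intervalIntegrable _ _)
        (hppc.intervalIntegrable _ _)]
      have : ∫ x in (0:ℝ)..P, hpp h x t = 0 :=
        int_deriv2_aux P (fun x => h x t) hs2 (fun x => hper x t ht')
      rw [this, add_zero]
    have hch := cheb_aux P α hP hα _ hrc hrp
    rw [hL] at hch
    have hc2 : Continuous fun x => (h x t + hpp h x t) ^ (-α) :=
      hrc.rpow_const fun x => Or.inl (hrp x).ne'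
    simp_rw [heq]
    rw [intervalIntegral.integral_add (Continuous.intervalIntegrable (by fun_prop) _ _)
      (continuous_const.intervalIntegrable _ _), intervalIntegral.integral_neg,
      intervalIntegral.integral_const, smul_eq_mul, sub_zero]
    unfold lamAP
    linarith
end

section
/- Let m ≥ 1 be an integer, α > 0, and let h : ℝ × [0,T) → ℝ be a smooth solution of the length-preserving (LP) support-function flow, 2mπ-periodic in θ, with h + h_θθ > 0 everywhere. Then the length L(t) = ∫₀^{2mπ} h(θ,t) dθ is constant in t, while the enclosed algebraic area A(t) = (1/2)∫₀^{2mπ} h(θ,t)(h(θ,t) + h_θθ(θ,t)) dθ is nondecreasing in t. -/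
open Real MeasureTheory Filter

/-- Nonlocal term of the length-preserving support-function flow. -/
noncomputable def lamLP (m : ℕ) (α : ℝ) (h : ℝ → ℝ → ℝ) (t : ℝ) : ℝ :=
  (1 / (2 * m * π)) * ∫ θ in (0:ℝ)..(2 * m * π), (h θ t + hpp h θ t) ^ (-α)


lemma aux_uniqueDiff (T : ℝ) : 
    UniqueDiffOn ℝ ((Set.univ : Set ℝ) ×ˢ Set.Ico (0:ℝ) T) :=
  uniqueDiffOn_univ.prod (uniqueDiffOn_Ico 0 T)

lemma aux_slice_s10 (T : ℝ) (g : ℝ → ℝ → ℝ)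
    (hg : ContDiffOn ℝ (⊤ : ℕ∞) (Function.uncurry g) (Set.univ ×ˢ Set.Ico (0:ℝ) T))
    (t : ℝ) (ht : t ∈ Set.Ico (0:ℝ) T) : ContDiff ℝ (⊤ : ℕ∞) (fun x => g x t) := by
  rw [← contDiffOn_univ]
  have : ContDiffOn ℝ (⊤ : ℕ∞) (fun x : ℝ => (x, t)) Set.univ := by fun_prop
  exact hg.comp this (fun x _ => ⟨trivial, ht⟩)

lemma aux_dtheta_s10 (T : ℝ) (g : ℝ → ℝ → ℝ)
    (hg : ContDiffOn ℝ (⊤ : ℕ∞) (Function.uncurry g) (Set.univ ×ˢ Set.Ico (0:ℝ) T)) :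
    ContDiffOn ℝ (⊤ : ℕ∞) (Function.uncurry (fun θ t => deriv (fun x => g x t) θ))
      (Set.univ ×ˢ Set.Ico (0:ℝ) T) := by
  have h1 : ContDiffOn ℝ (⊤ : ℕ∞) (fun p => fderivWithin ℝ (Function.uncurry g)
      (Set.univ ×ˢ Set.Ico (0:ℝ) T) p ((1:ℝ), (0:ℝ))) (Set.univ ×ˢ Set.Ico (0:ℝ) T) :=
    (hg.fderivWithin (aux_uniqueDiff T) (by simp)).clm_apply contDiffOn_const
  refine h1.congr ?_
  rintro ⟨θ, t⟩ ⟨-, ht⟩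
  have hd : HasFDerivWithinAt (Function.uncurry g) (fderivWithin ℝ (Function.uncurry g)
      (Set.univ ×ˢ Set.Ico (0:ℝ) T) (θ, t)) (Set.univ ×ˢ Set.Ico (0:ℝ) T) (θ, t) :=
    ((hg.differentiableOn (by simp)) (θ, t) ⟨trivial, ht⟩).hasFDerivWithinAt
  have hc : HasDerivAt (fun x : ℝ => (x, t)) ((1:ℝ), (0:ℝ)) θ :=
    (hasDerivAt_id θ).prodMk (hasDerivAt_const θ t)
  have hev : ∀ᶠ x in nhds θ, (x, t) ∈ (Set.univ : Set ℝ) ×ˢ Set.Ico (0:ℝ) T :=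
    Eventually.of_forall fun x => ⟨trivial, ht⟩
  exact (hd.comp_hasDerivAt θ hc hev).deriv

lemma aux_hpp (T : ℝ) (g : ℝ → ℝ → ℝ)
    (hg : ContDiffOn ℝ (⊤ : ℕ∞) (Function.uncurry g) (Set.univ ×ˢ Set.Ico (0:ℝ) T)) :
    ContDiffOn ℝ (⊤ : ℕ∞) (Function.uncurry (hpp g)) (Set.univ ×ˢ Set.Ico (0:ℝ) T) := by
  have h2 := aux_dtheta_s10 T _ (aux_dtheta_s10 T g hg)
  refine h2.congr ?_
  rintro ⟨θ, t⟩ -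
  simp only [Function.uncurry, hpp, iteratedDeriv_succ, iteratedDeriv_zero]

lemma aux_cont (T b : ℝ) (g : ℝ → ℝ → ℝ)
    (hg : ContDiffOn ℝ (⊤ : ℕ∞) (Function.uncurry g) (Set.univ ×ˢ Set.Ico (0:ℝ) T)) :
    ContinuousOn (fun t => ∫ θ in (0:ℝ)..b, g θ t) (Set.Ico 0 T) := by
  rw [continuousOn_iff_continuous_domRestrict]
  have hc : Continuous (Function.uncurry (fun (t : Set.Ico (0:ℝ) T) (θ : ℝ) => g θ t)) := by
    have h1 : Continuous (fun p : Set.Ico (0:ℝ) T × ℝ => (p.2, (p.1 : ℝ))) := by fun_prop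
    exact hg.continuousOn.comp_continuous h1 (fun p => ⟨trivial, p.1.2⟩)
  exact intervalIntegral.continuous_parametric_intervalIntegral_of_continuous' hc 0 b

lemma aux_dt_s10 (T b : ℝ) (g : ℝ → ℝ → ℝ)
    (hg : ContDiffOn ℝ (⊤ : ℕ∞) (Function.uncurry g) (Set.univ ×ˢ Set.Ico (0:ℝ) T))
    (t : ℝ) (ht : t ∈ Set.Ioo (0:ℝ) T) :
    (∀ θ, DifferentiableAt ℝ (fun s => g θ s) t) ∧
    IntervalIntegrable (fun θ => deriv (fun s => g θ s) t) volume 0 b ∧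
    HasDerivAt (fun s => ∫ θ in (0:ℝ)..b, g θ s) (∫ θ in (0:ℝ)..b, deriv (fun s => g θ s) t) t := by
  set S := (Set.univ : Set ℝ) ×ˢ Set.Ico (0:ℝ) T with hS
  have h1 : ContDiffOn ℝ (⊤ : ℕ∞) (fun p => fderivWithin ℝ (Function.uncurry g) S p
      ((0:ℝ), (1:ℝ))) S :=
    (hg.fderivWithin (aux_uniqueDiff T) (by simp)).clm_apply contDiffOn_const
  have hder : ∀ s ∈ Set.Ioo (0:ℝ) T, ∀ θ, HasDerivAt (fun s => g θ s)
      (fderivWithin ℝ (Function.uncurry g) S (θ, s) ((0:ℝ), (1:ℝ))) s := by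
    intro s hs θ
    have hd : HasFDerivWithinAt (Function.uncurry g) (fderivWithin ℝ (Function.uncurry g)
        S (θ, s)) S (θ, s) :=
      ((hg.differentiableOn (by simp)) (θ, s) ⟨trivial, Set.Ioo_subset_Ico_self hs⟩).hasFDerivWithinAt
    have hc : HasDerivAt (fun x : ℝ => (θ, x)) ((0:ℝ), (1:ℝ)) s :=
      (hasDerivAt_const s θ).prodMk (hasDerivAt_id s)
    refine hd.comp_hasDerivAt s hc ?_
    filter_upwards [isOpen_Ioo.mem_nhds hs] with x hx
    exact ⟨trivial, Set.Ioo_subset_Ico_self hx⟩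
  have hsl : ∀ s ∈ Set.Ico (0:ℝ) T, Continuous (fun θ => g θ s) := fun s hs =>
    (aux_slice_s10 T g hg s hs).continuous
  have hsl' : Continuous (fun θ => fderivWithin ℝ (Function.uncurry g) S (θ, t) ((0:ℝ), (1:ℝ))) :=
    h1.continuousOn.comp_continuous (f := fun θ : ℝ => (θ, t)) (by fun_prop)
      (fun p => ⟨trivial, Set.Ioo_subset_Ico_self ht⟩)
  obtain ⟨a, c, hac, hnhds, hsub⟩ : ∃ a c, t ∈ Set.Ioo a c ∧ Set.Icc a c ∈ nhds t ∧
      Set.Icc a c ⊆ Set.Ioo 0 T := by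
    refine ⟨t / 2, (t + T) / 2, ⟨by linarith [ht.1], by linarith [ht.2]⟩,
      Icc_mem_nhds (by linarith [ht.1]) (by linarith [ht.2]), ?_⟩
    intro x hx
    exact ⟨by linarith [ht.1, hx.1], by linarith [ht.2, hx.2]⟩
  obtain ⟨C, hC⟩ := (isCompact_uIcc (a := (0:ℝ)) (b := b)).prod (isCompact_Icc (a := a) (b := c))
    |>.exists_bound_of_continuousOn (h1.continuousOn.mono (by
      rintro ⟨x, y⟩ ⟨-, hy⟩
      exact ⟨trivial, Set.Ioo_subset_Ico_self (hsub hy)⟩))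
  have key := intervalIntegral.hasDerivAt_integral_of_dominated_loc_of_deriv_le
    (μ := volume) (a := 0) (b := b) (F := fun s θ => g θ s)
    (F' := fun s θ => fderivWithin ℝ (Function.uncurry g) S (θ, s) ((0:ℝ), (1:ℝ)))
    (bound := fun _ => C) hnhds
    (by
      filter_upwards [hnhds] with s hs
      exact (hsl s (Set.Ioo_subset_Ico_self (hsub hs))).aestronglyMeasurable)
    ((hsl t (Set.Ioo_subset_Ico_self ht)).intervalIntegrable _ _)
    hsl'.aestronglyMeasurable
    (Eventually.of_forall fun θ hθ s hs => hC (θ, s) ⟨Set.uIoc_subset_uIcc hθ, hs⟩)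
    (by simp)
    (Eventually.of_forall fun θ hθ s hs => hder s (hsub hs) θ)
  have e : (fun θ => deriv (fun s => g θ s) t) =
      fun θ => fderivWithin ℝ (Function.uncurry g) S (θ, t) ((0:ℝ), (1:ℝ)) := by
    funext θ
    exact (hder t ht θ).deriv
  refine ⟨fun θ => (hder t ht θ).differentiableAt, ?_, ?_⟩
  · rw [e]; exact key.1
  · rw [e]; exact key.2

lemma aux_selfadj_s10 (P : ℝ) (u v : ℝ → ℝ) (hu : ContDiff ℝ (⊤ : ℕ∞) u) (hv : ContDiff ℝ (⊤ : ℕ∞) v)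
    (pu : ∀ x, u (x + P) = u x) (pv : ∀ x, v (x + P) = v x) :
    ∫ x in (0:ℝ)..P, u x * (v x + iteratedDeriv 2 v x) =
      ∫ x in (0:ℝ)..P, v x * (u x + iteratedDeriv 2 u x) := by
  have key : ∀ w : ℝ → ℝ, ContDiff ℝ (⊤ : ℕ∞) w → (∀ x, w (x + P) = w x) →
      (∀ x, HasDerivAt w (deriv w x) x) ∧ (∀ x, HasDerivAt (deriv w) (iteratedDeriv 2 w x) x) ∧
      Continuous w ∧ Continuous (iteratedDeriv 2 w) ∧ w P = w 0 ∧ deriv w P = deriv w 0 := by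
    intro w hw pw
    have hw1 : ContDiff ℝ (⊤ : ℕ∞) (deriv w) := by
      have := hw.iterate_deriv 1
      simpa using this
    have e2 : iteratedDeriv 2 w = deriv (deriv w) := by
      simp [iteratedDeriv_succ]
    have hw2 : ContDiff ℝ (⊤ : ℕ∞) (deriv (deriv w)) := by
      have := hw1.iterate_deriv 1
      simpa using this
    refine ⟨fun x => (hw.differentiable (by simp) x).hasDerivAt, fun x => ?_, hw.continuous, ?_,
      ?_, ?_⟩
    · rw [e2]; exact (hw1.differentiable (by simp) x).hasDerivAt
    · rw [e2]; exact hw2.continuous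
    · simpa using pw 0
    · have := deriv_comp_add_const w P 0
      rw [show (fun x => w (x + P)) = w from funext pw] at this
      simpa using this.symm
  obtain ⟨u1, u2, uc, uc2, uP, uP'⟩ := key u hu pu
  obtain ⟨v1, v2, vc, vc2, vP, vP'⟩ := key v hv pv
  rw [← sub_eq_zero, ← intervalIntegral.integral_sub
    ((by fun_prop : Continuous _).intervalIntegrable _ _)
    ((by fun_prop : Continuous _).intervalIntegrable _ _)]
  rw [intervalIntegral.integral_eq_sub_of_hasDerivAt
    (f := fun x => u x * deriv v x - v x * deriv u x)]
  · simp only [uP, uP', vP, vP']; ring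
  · intro x _
    have := ((u1 x).mul (v2 x)).sub ((v1 x).mul (u2 x))
    refine this.congr_deriv ?_
    ring
  · exact (by fun_prop : Continuous _).intervalIntegrable _ _

lemma aux_cheb (P α : ℝ) (hP : 0 < P) (hα : 0 < α) (w : ℝ → ℝ) (hw : Continuous w)
    (wpos : ∀ x, 0 < w x) (l : ℝ) (hl : l = (1 / P) * ∫ x in (0:ℝ)..P, w x ^ (-α)) :
    (∫ x in (0:ℝ)..P, (-(w x) ^ (-α) + l)) = 0 ∧
    0 ≤ ∫ x in (0:ℝ)..P, (-(w x) ^ (-α) + l) * w x := by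
  have cp : Continuous (fun x => w x ^ (-α)) :=
    hw.rpow_const (fun x => Or.inl (wpos x).ne')
  have hz : (∫ x in (0:ℝ)..P, (-(w x) ^ (-α) + l)) = 0 := by
    have cn : Continuous (fun x => -(w x) ^ (-α)) := cp.neg
    rw [intervalIntegral.integral_add (cn.intervalIntegrable _ _) intervalIntegrable_const,
      intervalIntegral.integral_neg, intervalIntegral.integral_const, hl]
    simp only [sub_zero, smul_eq_mul]
    field_simp
    ring
  refine ⟨hz, ?_⟩
  have lpos : 0 < l := by
    rw [hl]
    refine mul_pos (by positivity) ?_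
    exact intervalIntegral.intervalIntegral_pos_of_pos (cp.intervalIntegrable _ _)
      (fun x => Real.rpow_pos_of_pos (wpos x) _) hP
  obtain ⟨c, cpos, hc⟩ : ∃ c : ℝ, 0 < c ∧ c ^ (-α) = l := by
    refine ⟨l ^ (-α)⁻¹, Real.rpow_pos_of_pos lpos _, ?_⟩
    rw [← Real.rpow_mul lpos.le, inv_mul_cancel₀ (by linarith), Real.rpow_one]
  have h0 : 0 ≤ ∫ x in (0:ℝ)..P, (-(w x) ^ (-α) + l) * (w x - c) := by
    refine intervalIntegral.integral_nonneg hP.le fun x _ => ?_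
    rw [← hc]
    rcases le_total (w x) c with hx | hx
    · have := Real.rpow_le_rpow_of_nonpos (wpos x) hx (by linarith : -α ≤ 0)
      exact mul_nonneg_of_nonpos_of_nonpos (by linarith) (by linarith)
    · have := Real.rpow_le_rpow_of_nonpos cpos hx (by linarith : -α ≤ 0)
      exact mul_nonneg (by linarith) (by linarith)
  have e : (∫ x in (0:ℝ)..P, (-(w x) ^ (-α) + l) * (w x - c)) =
      (∫ x in (0:ℝ)..P, (-(w x) ^ (-α) + l) * w x)
        - (∫ x in (0:ℝ)..P, (-(w x) ^ (-α) + l)) * c := by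
    rw [← intervalIntegral.integral_mul_const, ← intervalIntegral.integral_sub
      ((by fun_prop : Continuous _).intervalIntegrable _ _)
      ((by fun_prop : Continuous _).intervalIntegrable _ _)]
    congr 1; funext x; ring
  rw [hz] at e
  linarith

/-- Along the LP support-function flow on `[0,T)`, the length is constant in time and
the enclosed algebraic area is nondecreasing. -/
theorem lp_flow_preserves_length_and_area_nondecreasing
    (m : ℕ) (hm : 1 ≤ m) (α T : ℝ) (hα : 0 < α) (hT : 0 < T) (h : ℝ → ℝ → ℝ)
    (hsmooth : ContDiffOn ℝ (⊤ : ℕ∞) (Function.uncurry h) (Set.univ ×ˢ Set.Ico (0:ℝ) T))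
    (hper : ∀ θ, ∀ t ∈ Set.Ico (0:ℝ) T, h (θ + 2 * m * π) t = h θ t)
    (hconv : ∀ θ, ∀ t ∈ Set.Ico (0:ℝ) T, 0 < h θ t + hpp h θ t)
    (hflow : ∀ θ, ∀ t ∈ Set.Ico (0:ℝ) T,
      derivWithin (fun s => h θ s) (Set.Ico 0 T) t
        = -(h θ t + hpp h θ t) ^ (-α) + lamLP m α h t) :
    (∀ t ∈ Set.Ico (0:ℝ) T, len m h t = len m h 0) ∧
      MonotoneOn (area m h) (Set.Ico 0 T) := by
  have hP : 0 < 2 * (m:ℝ) * π := by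
    have : (0:ℝ) < m := by exact_mod_cast hm
    positivity
  set w : ℝ → ℝ → ℝ := fun θ t => h θ t + hpp h θ t with hw
  have ws : ContDiffOn ℝ (⊤ : ℕ∞) (Function.uncurry w) (Set.univ ×ˢ Set.Ico (0:ℝ) T) :=
    hsmooth.add (aux_hpp T h hsmooth)
  have hws : ContDiffOn ℝ (⊤ : ℕ∞) (Function.uncurry fun θ t => h θ t * w θ t)
      (Set.univ ×ˢ Set.Ico (0:ℝ) T) := hsmooth.mul ws
  have hch : ∀ t ∈ Set.Ico (0:ℝ) T, _ := fun t ht =>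
    aux_cheb (2 * m * π) α hP hα (fun θ => w θ t) (aux_slice_s10 T w ws t ht).continuous
      (fun θ => hconv θ t ht) (lamLP m α h t) rfl
  have hdt : ∀ t ∈ Set.Ioo (0:ℝ) T, ∀ θ, deriv (fun s => h θ s) t
      = -(w θ t) ^ (-α) + lamLP m α h t := by
    intro t ht θ
    rw [← hflow θ t (Set.Ioo_subset_Ico_self ht),
      derivWithin_of_mem_nhds (Ico_mem_nhds ht.1 ht.2)]
  have hlen : ∀ t ∈ Set.Ioo (0:ℝ) T, HasDerivAt (len m h) 0 t := by
    intro t ht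
    have := (aux_dt_s10 T (2 * m * π) h hsmooth t ht).2.2
    simp only [hdt t ht] at this
    rw [(hch t (Set.Ioo_subset_Ico_self ht)).1] at this
    exact this
  have harea : ∀ t ∈ Set.Ioo (0:ℝ) T, ∃ d, 0 ≤ d ∧ HasDerivAt (area m h) d t := by
    intro t ht
    have ht' := Set.Ioo_subset_Ico_self ht
    have hct : Continuous (fun θ => h θ t) := (aux_slice_s10 T h hsmooth t ht').continuous
    have wct : Continuous (fun θ => w θ t) := (aux_slice_s10 T w ws t ht').continuous
    have sfst : ∀ f : ℝ → ℝ, ContDiff ℝ (⊤ : ℕ∞) f →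
        ContDiffOn ℝ (⊤ : ℕ∞) (fun p : ℝ × ℝ => f p.1) (Set.univ ×ˢ Set.Ico (0:ℝ) T) :=
      fun f hf => (hf.comp contDiff_fst).contDiffOn
    obtain ⟨dh, ih, -⟩ := aux_dt_s10 T (2 * m * π) h hsmooth t ht
    obtain ⟨dw, iw, -⟩ := aux_dt_s10 T (2 * m * π) w ws t ht
    have A0 := (aux_dt_s10 T (2 * m * π) (fun θ s => h θ s * w θ s) hws t ht).2.2
    have A1 := (aux_dt_s10 T (2 * m * π) (fun θ s => h θ s * w θ t)
      (hsmooth.mul (sfst _ (aux_slice_s10 T w ws t ht'))) t ht).2.2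
    have A2 := (aux_dt_s10 T (2 * m * π) (fun θ s => h θ t * w θ s)
      ((sfst _ (aux_slice_s10 T h hsmooth t ht')).mul ws) t ht).2.2
    have e0 : ∀ θ, deriv (fun s => h θ s * w θ s) t =
        deriv (fun s => h θ s) t * w θ t + h θ t * deriv (fun s => w θ s) t :=
      fun θ => deriv_fun_mul (dh θ) (dw θ)
    have e1 : ∀ θ, deriv (fun s => h θ s * w θ t) t = deriv (fun s => h θ s) t * w θ t :=
      fun θ => deriv_mul_const (dh θ) _
    have e2 : ∀ θ, deriv (fun s => h θ t * w θ s) t = h θ t * deriv (fun s => w θ s) t :=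
      fun θ => deriv_const_mul _ (dw θ)
    simp only [e0] at A0
    simp only [e1] at A1
    simp only [e2] at A2
    have hE : (fun s => ∫ θ in (0:ℝ)..(2 * m * π), h θ s * w θ t) =ᶠ[nhds t]
        fun s => ∫ θ in (0:ℝ)..(2 * m * π), h θ t * w θ s := by
      filter_upwards [Ioo_mem_nhds ht.1 ht.2] with s hs
      have hs' := Set.Ioo_subset_Ico_self hs
      exact aux_selfadj_s10 (2 * m * π) (fun θ => h θ s) (fun θ => h θ t)
        (aux_slice_s10 T h hsmooth s hs') (aux_slice_s10 T h hsmooth t ht')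
        (fun x => hper x s hs') (fun x => hper x t ht')
    have hEq := A1.unique (A2.congr_of_eventuallyEq hE)
    rw [intervalIntegral.integral_add (ih.mul_continuousOn wct.continuousOn)
      (iw.continuousOn_mul hct.continuousOn), ← hEq] at A0
    have hpos := (hch t ht').2
    simp only [← hdt t ht] at hpos
    exact ⟨_, by positivity, A0.const_mul (1 / 2)⟩
  have clen : ContinuousOn (len m h) (Set.Ico 0 T) := aux_cont T _ h hsmooth
  have carea : ContinuousOn (area m h) (Set.Ico 0 T) :=
    continuousOn_const.mul (aux_cont T (2 * m * π) _ hws)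
  constructor
  · intro t ht
    have dl : DifferentiableOn ℝ (len m h) (interior (Set.Ico 0 T)) := by
      rw [interior_Ico]
      exact fun x hx => (hlen x hx).differentiableAt.differentiableWithinAt
    have m1 := monotoneOn_of_deriv_nonneg (convex_Ico 0 T) clen dl (by
      rw [interior_Ico]
      exact fun x hx => (hlen x hx).deriv.ge)
    have m2 := antitoneOn_of_deriv_nonpos (convex_Ico 0 T) clen dl (by
      rw [interior_Ico]
      exact fun x hx => (hlen x hx).deriv.le)
    have h0 : (0:ℝ) ∈ Set.Ico 0 T := ⟨le_rfl, hT⟩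
    exact le_antisymm (m2 h0 ht ht.1) (m1 h0 ht ht.1)
  · refine monotoneOn_of_deriv_nonneg (convex_Ico 0 T) carea ?_ ?_
    · rw [interior_Ico]
      intro x hx
      obtain ⟨d, -, hd⟩ := harea x hx
      exact hd.differentiableAt.differentiableWithinAt
    · rw [interior_Ico]
      intro x hx
      obtain ⟨d, hd0, hd⟩ := harea x hx
      rw [hd.deriv]; exact hd0
end

section
/- Let m ≥ 1 be an integer, α > 0, T > 0, and let λ : [0,T] → ℝ be continuous. Let κ : ℝ × [0,T] → (0,∞) be a smooth function, 2mπ-periodic in θ, satisfying κ_t = κ²((κ^α)_θθ + κ^α − λ(t)). Then for every (θ,t) ∈ ℝ × [0,T], 1/κ(θ,t) ≤ max_{θ'} (1/κ(θ',0)) + (L(t) − L(0))/(2mπ) + (1/(2mπ)) ∫₀ᵗ ∫₀^{2mπ} κ^α(θ',τ) dθ' dτ, where L(t) = ∫₀^{2mπ} κ(θ,t)^{−1} dθ. (This is the maximum-principle estimate underlying the preservation of local convexity along both the AP and LP flows.) -/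
open Real MeasureTheory Filter

/-- Length of the curve of curvature `κ(·,t)` in the normal-angle parametrization:
`L(t) = ∫₀^{2mπ} κ⁻¹ dθ`. -/
noncomputable def lenOfCurv (m : ℕ) (κ : ℝ → ℝ → ℝ) (t : ℝ) : ℝ :=
  ∫ θ in (0:ℝ)..(2 * m * π), (κ θ t)⁻¹

theorem aux_second_deriv_nonneg {f : ℝ → ℝ} {x : ℝ} (hf : Continuous f) (h : IsLocalMin f x) :
    0 ≤ deriv (deriv f) x := by
  by_contra! hneg
  have hmax := isLocalMax_of_deriv_deriv_neg hneg h.deriv_eq_zero hf.continuousAt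
  have hc : f =ᶠ[nhds x] fun _ => f x := by
    filter_upwards [h, hmax] with y h1 h2
    exact le_antisymm h2 h1
  have h2 := hc.deriv.deriv_eq
  simp at h2
  linarith

theorem aux_left_deriv_nonneg {g : ℝ → ℝ} {g' T t : ℝ} (ht : t ∈ Set.Icc 0 T) (ht0 : 0 < t)
    (hg : HasDerivWithinAt g g' (Set.Icc 0 T) t) (hmax : ∀ s ∈ Set.Icc 0 T, g s ≤ g t) :
    0 ≤ g' := by
  have h1 : IsLocalMaxOn g (Set.Icc 0 T) t := IsMaxOn.localize hmax
  have h2 : (0 - t) ∈ posTangentConeAt (Set.Icc 0 T) t :=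
    sub_mem_posTangentConeAt_of_segment_subset
      ((convex_Icc 0 T).segment_subset ht ⟨le_refl _, ht.1.trans ht.2⟩)
  have h3 := h1.hasFDerivWithinAt_nonpos hg.hasFDerivWithinAt h2
  simp at h3
  nlinarith

/-- The maximum-principle estimate underlying the preservation of local convexity:
along `κ_t = κ²((κ^α)_θθ + κ^α − λ(t))`,
`1/κ(θ,t) ≤ max_θ' 1/κ(θ',0) + (L(t) − L(0))/(2mπ) + (1/(2mπ))∫₀ᵗ∫₀^{2mπ} κ^α dθ' dτ`. -/
theorem curvature_reciprocal_maximum_principle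
    (m : ℕ) (hm : 1 ≤ m) (α T : ℝ) (hα : 0 < α) (hT : 0 < T)
    (lam : ℝ → ℝ) (hlam : ContinuousOn lam (Set.Icc 0 T))
    (κ : ℝ → ℝ → ℝ)
    (hpos : ∀ θ, ∀ t ∈ Set.Icc (0:ℝ) T, 0 < κ θ t)
    (hsmooth : ContDiffOn ℝ (⊤ : ℕ∞) (Function.uncurry κ) (Set.univ ×ˢ Set.Icc (0:ℝ) T))
    (hper : ∀ θ, ∀ t ∈ Set.Icc (0:ℝ) T, κ (θ + 2 * m * π) t = κ θ t)
    (hflow : ∀ θ, ∀ t ∈ Set.Icc (0:ℝ) T,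
      derivWithin (fun s => κ θ s) (Set.Icc 0 T) t
        = κ θ t ^ 2 *
          (iteratedDeriv 2 (fun x => κ x t ^ α) θ + κ θ t ^ α - lam t)) :
    ∀ θ, ∀ t ∈ Set.Icc (0:ℝ) T,
      (κ θ t)⁻¹ ≤ (⨆ θ' : ℝ, (κ θ' 0)⁻¹)
        + (lenOfCurv m κ t - lenOfCurv m κ 0) / (2 * m * π)
        + (1 / (2 * m * π)) *
            ∫ τ in (0:ℝ)..t, ∫ x in (0:ℝ)..(2 * m * π), κ x τ ^ α := by
  have hmR : (0:ℝ) < m := by exact_mod_cast hm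
  set P : ℝ := 2 * m * π with hP
  have hPpos : 0 < P := by positivity
  set I : Set ℝ := Set.Icc 0 T with hI
  set S : Set (ℝ × ℝ) := Set.univ ×ˢ I with hS
  have h0I : (0:ℝ) ∈ I := ⟨le_refl _, hT.le⟩
  have hmem : ∀ x, ∀ t ∈ I, (x, t) ∈ S := fun x t ht => ⟨trivial, ht⟩
  have hUS : UniqueDiffOn ℝ S := uniqueDiffOn_univ.prod (uniqueDiffOn_Icc hT)
  have hκc : ContinuousOn (fun p : ℝ × ℝ => κ p.1 p.2) S := hsmooth.continuousOn
  have hpS : ∀ p ∈ S, 0 < κ p.1 p.2 := fun p hp => hpos p.1 p.2 hp.2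
  have hspace : ∀ t ∈ I, ContDiff ℝ 2 (fun x => κ x t ^ α) := by
    intro t ht
    have h1 : ContDiff ℝ 2 (fun x => κ x t) := by
      rw [← contDiffOn_univ]
      have h2 : ContDiffOn ℝ 2 (Function.uncurry κ) S := hsmooth.of_le (WithTop.coe_le_coe.2 le_top)
      exact h2.comp (f := fun x : ℝ => (x, t)) (by fun_prop) (fun x _ => hmem x t ht)
    exact h1.rpow_const_of_ne (fun x => (hpos x t ht).ne')
  set D : ℝ × ℝ → ℝ := fun p => fderivWithin ℝ (Function.uncurry κ) S p (0, 1) with hD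
  have hDc : ContinuousOn D S :=
    (hsmooth.continuousOn_fderivWithin hUS (by simp)).clm_apply continuousOn_const
  have hκt : ∀ x, ∀ t ∈ I, HasDerivWithinAt (fun s => κ x s) (D (x, t)) I t := by
    intro x t ht
    have h1 := ((hsmooth.differentiableOn (by simp)) (x, t) (hmem x t ht)).hasFDerivWithinAt
    have h2 : HasDerivWithinAt (fun s : ℝ => (x, s)) ((0:ℝ), (1:ℝ)) I t :=
      (hasDerivWithinAt_const t I x).prodMk (hasDerivWithinAt_id t I)
    exact h1.comp_hasDerivWithinAt t h2 (fun s hs => hmem x s hs)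
  set F : ℝ → ℝ → ℝ := fun x t =>
    lam t - κ x t ^ α - deriv (deriv (fun y => κ y t ^ α)) x with hF
  have hFD : ∀ x, ∀ t ∈ I, -D (x, t) / κ x t ^ 2 = F x t := by
    intro x t ht
    have h1 := hflow x t ht
    rw [(hκt x t ht).derivWithin (uniqueDiffOn_Icc hT t ht), iteratedDeriv_succ,
      iteratedDeriv_one] at h1
    have h2 := (hpos x t ht).ne'
    rw [h1, hF]
    field_simp
    ring
  have hv : ∀ x, ∀ t ∈ I, HasDerivWithinAt (fun s => (κ x s)⁻¹) (F x t) I t := by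
    intro x t ht
    rw [← hFD x t ht]
    exact (hκt x t ht).fun_inv (hpos x t ht).ne'
  have hFc : ContinuousOn (Function.uncurry F) S := by
    have : ContinuousOn (fun p : ℝ × ℝ => -D p / κ p.1 p.2 ^ 2) S :=
      hDc.neg.div (hκc.pow 2) (fun p hp => pow_ne_zero 2 (hpS p hp).ne')
    exact this.congr (fun p hp => (hFD p.1 p.2 hp.2).symm)
  have hvc : ContinuousOn (fun p : ℝ × ℝ => (κ p.1 p.2)⁻¹) S :=
    hκc.inv₀ (fun p hp => (hpS p hp).ne')
  set lam' : ℝ → ℝ := Set.IccExtend hT.le (I.domRestrict lam) with hlam'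
  have hlc : Continuous lam' := (continuousOn_iff_continuous_domRestrict.1 hlam).Icc_extend'
  have hle : ∀ t ∈ I, lam' t = lam t := fun t ht => Set.IccExtend_of_mem hT.le _ ht
  set Λ : ℝ → ℝ := fun t => ∫ s in (0:ℝ)..t, lam' s with hΛ
  have hΛd : ∀ t, HasDerivAt Λ (lam' t) t := fun t => hlc.integral_hasStrictDerivAt 0 t |>.hasDerivAt
  have hΛc : Continuous Λ := continuous_iff_continuousAt.2 fun t => (hΛd t).continuousAt
  have hmaxp : ∀ θ, ∀ t ∈ I, (κ θ t)⁻¹ - Λ t ≤ ⨆ θ' : ℝ, (κ θ' 0)⁻¹ := by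
    have hcpt : IsCompact (Set.Icc 0 P ×ˢ I) := isCompact_Icc.prod isCompact_Icc
    have hwc : ContinuousOn (fun p : ℝ × ℝ => (κ p.1 p.2)⁻¹ - Λ p.2) S :=
      hvc.sub (hΛc.comp continuous_snd).continuousOn
    obtain ⟨⟨θ₀, t₀⟩, hp, hmax⟩ := hcpt.exists_isMaxOn (⟨(0, 0), ⟨le_refl _, hPpos.le⟩, h0I⟩)
      (hwc.mono (Set.prod_mono (Set.subset_univ _) le_rfl))
    have ht₀ : t₀ ∈ I := hp.2
    have hmax' : ∀ θ, ∀ t ∈ I, (κ θ t)⁻¹ - Λ t ≤ (κ θ₀ t₀)⁻¹ - Λ t₀ := by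
      intro θ t ht
      have hperi : Function.Periodic (fun x => κ x t) P := fun x => hper x t ht
      obtain ⟨y, hy, hxy⟩ := hperi.exists_mem_Ico₀ hPpos θ
      have := hmax (a := (y, t)) ⟨Set.Ico_subset_Icc_self hy, ht⟩
      have hxy' : κ θ t = κ y t := hxy
      rw [hxy']
      exact this
    have ht0 : t₀ = 0 := by
      by_contra hne
      have hpos0 : 0 < t₀ := lt_of_le_of_ne ht₀.1 (Ne.symm hne)
      have h1 := aux_left_deriv_nonneg ht₀ hpos0
        ((hv θ₀ t₀ ht₀).sub (hΛd t₀).hasDerivWithinAt) (fun s hs => hmax' θ₀ s hs)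
      have h2 : 0 ≤ deriv (deriv (fun y => κ y t₀ ^ α)) θ₀ := by
        apply aux_second_deriv_nonneg (hspace t₀ ht₀).continuous
        refine Filter.Eventually.of_forall fun y => ?_
        have h3 := hmax' y t₀ ht₀
        have h4 : (κ y t₀)⁻¹ ≤ (κ θ₀ t₀)⁻¹ := by linarith
        rw [inv_le_inv₀ (hpos _ _ ht₀) (hpos _ _ ht₀)] at h4
        exact Real.rpow_le_rpow (hpos _ _ ht₀).le h4 hα.le
      have h5 : 0 < κ θ₀ t₀ ^ α := Real.rpow_pos_of_pos (hpos _ _ ht₀) _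
      rw [hle t₀ ht₀] at h1
      simp only [hF] at h1
      linarith
    subst ht0
    have hΛ0 : Λ 0 = 0 := by simp [hΛ]
    intro θ t ht
    refine (hmax' θ t ht).trans ?_
    rw [hΛ0, sub_zero]
    apply le_ciSup (f := fun θ' : ℝ => (κ θ' 0)⁻¹)
    refine ⟨(κ θ₀ 0)⁻¹, ?_⟩
    rintro _ ⟨y, rfl⟩
    have := hmax' y 0 h0I
    simpa using this
  intro θ t ht
  have hsub : Set.Icc 0 t ⊆ I := Set.Icc_subset_Icc_right ht.2
  have huI : Set.uIcc 0 t ⊆ I := by rw [Set.uIcc_of_le ht.1]; exact hsub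
  have hinner : ∀ τ ∈ I, ∫ x in (0:ℝ)..P, F x τ = P * lam' τ - ∫ x in (0:ℝ)..P, κ x τ ^ α := by
    intro τ hτ
    have hs := hspace τ hτ
    have hd1 : ContDiff ℝ 1 (deriv (fun y => κ y τ ^ α)) :=
      ((contDiff_succ_iff_deriv (n := 1)).1 hs).2.2
    have hd2 : Continuous (deriv (deriv (fun y => κ y τ ^ α))) := hd1.continuous_deriv le_rfl
    have h1 : ∫ x in (0:ℝ)..P, deriv (deriv (fun y => κ y τ ^ α)) x = 0 := by
      rw [intervalIntegral.integral_deriv_eq_sub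
        (fun x _ => (hd1.differentiable (by simp)).differentiableAt) (hd2.intervalIntegrable _ _)]
      have h2 := deriv_comp_add_const (fun y => κ y τ ^ α) P 0
      have h3 : (fun y => κ (y + P) τ ^ α) = fun y => κ y τ ^ α := by
        funext y; rw [hper y τ hτ]
      rw [h3, zero_add] at h2
      rw [h2, sub_self]
    simp only [hF]
    rw [intervalIntegral.integral_sub, intervalIntegral.integral_sub, h1, hle τ hτ]
    · simp
    · exact intervalIntegrable_const
    · exact hs.continuous.intervalIntegrable _ _
    · exact (continuous_const.sub hs.continuous).intervalIntegrable _ _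
    · exact hd2.intervalIntegrable _ _
  have hAint : IntervalIntegrable (fun τ => ∫ x in (0:ℝ)..P, κ x τ ^ α) volume 0 t := by
    have hc : Continuous (fun p : ℝ × ℝ => κ p.2 (Set.projIcc 0 T hT.le p.1) ^ α) := by
      have hk : Continuous (fun p : ℝ × ℝ => κ p.2 (Set.projIcc 0 T hT.le p.1)) :=
        hκc.comp_continuous (f := fun p : ℝ × ℝ => (p.2, ((Set.projIcc 0 T hT.le p.1 : I) : ℝ)))
          (continuous_snd.prodMk
            (continuous_subtype_val.comp (continuous_projIcc.comp continuous_fst)))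
          (fun p => hmem _ _ (Subtype.coe_prop _))
      exact hk.rpow_const (fun p => Or.inr hα.le)
    have hA := intervalIntegral.continuous_parametric_intervalIntegral_of_continuous' (μ := volume)
      (f := fun τ x => κ x (Set.projIcc 0 T hT.le τ) ^ α) hc 0 P
    refine ContinuousOn.intervalIntegrable (hA.continuousOn.congr fun τ hτ => ?_)
    simp only [Set.projIcc_of_mem hT.le (huI hτ)]
  have hL : lenOfCurv m κ t - lenOfCurv m κ 0
      = P * Λ t - ∫ τ in (0:ℝ)..t, ∫ x in (0:ℝ)..P, κ x τ ^ α := by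
    have hvi : ∀ s ∈ I, IntervalIntegrable (fun x => (κ x s)⁻¹) volume 0 P := by
      intro s hs
      have : Continuous (fun x => (κ x s)⁻¹) :=
        hvc.comp_continuous (f := fun x : ℝ => (x, s)) (by fun_prop) (fun x => hmem x s hs)
      exact this.intervalIntegrable _ _
    unfold lenOfCurv
    rw [← hP, ← intervalIntegral.integral_sub (hvi t ht) (hvi 0 h0I)]
    have h1 : ∀ x, (κ x t)⁻¹ - (κ x 0)⁻¹ = ∫ τ in (0:ℝ)..t, F x τ := by
      intro x
      symm
      apply intervalIntegral.integral_eq_sub_of_hasDerivAt_of_le (f := fun s => (κ x s)⁻¹) ht.1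
      · exact fun s hs => ((hv x s (hsub hs)).continuousWithinAt).mono hsub
      · intro s hs
        exact (hv x s (hsub (Set.Ioo_subset_Icc_self hs))).hasDerivAt
          (Icc_mem_nhds hs.1 (hs.2.trans_le ht.2))
      · apply ContinuousOn.intervalIntegrable
        exact hFc.comp (f := fun s : ℝ => (x, s)) (by fun_prop) (fun s hs => hmem x s (huI hs))
    simp only [h1]
    rw [MeasureTheory.intervalIntegral_intervalIntegral_swap]
    · rw [intervalIntegral.integral_congr (fun τ hτ => hinner τ (huI hτ)),
        intervalIntegral.integral_sub ((hlc.intervalIntegrable _ _).const_mul P) hAint,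
        intervalIntegral.integral_const_mul]
    · have : IntegrableOn (Function.uncurry F) (Set.uIcc 0 P ×ˢ Set.uIcc 0 t) :=
        (hFc.mono (Set.prod_mono (Set.subset_univ _) huI)).integrableOn_compact
          (isCompact_uIcc.prod isCompact_uIcc)
      exact this.mono_set (Set.prod_mono Set.uIoc_subset_uIcc Set.uIoc_subset_uIcc)
  have hfin := hmaxp θ t ht
  rw [hL]
  have : (P * Λ t - ∫ τ in (0:ℝ)..t, ∫ x in (0:ℝ)..P, κ x τ ^ α) / P
      + (1 / P) * ∫ τ in (0:ℝ)..t, ∫ x in (0:ℝ)..P, κ x τ ^ α = Λ t := by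
    field_simp
    ring
  linarith
end

section
/- Let m ≥ 1 be an integer, α > 0, r₀ > 0, T > 0, and let λ : [0,T] → [0,∞) be continuous and nonnegative. Let h : ℝ × [0,T] → ℝ be smooth, 2mπ-periodic in θ, with h + h_θθ > 0 everywhere and h(θ,t) ≥ 2r₀ for all (θ,t), satisfying h_t = −(h + h_θθ)^{−α} + λ(t). Set κ = (h + h_θθ)^{−1}. Then for all (θ,t) ∈ ℝ × [0,T], κ(θ,t)^α / (h(θ,t) − r₀) ≤ max{ r₀^{−(α+1)} (1 + 1/α)^α , max_{θ'} κ(θ',0)^α / (h(θ',0) − r₀) }; consequently κ(θ,t) ≤ M^{1/α} (sup h − r₀)^{1/α} where M denotes the maximum above. -/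
/-- The closed strip. -/
def strip (T : ℝ) : Set (ℝ × ℝ) := Set.univ ×ˢ Set.Icc (0:ℝ) T

/-- Partial derivative in a direction, within the strip. -/
noncomputable def dd (T : ℝ) (v : ℝ × ℝ) (f : ℝ × ℝ → ℝ) (p : ℝ × ℝ) : ℝ :=
  fderivWithin ℝ f (strip T) p v

lemma strip_uniqueDiff {T : ℝ} (hT : 0 < T) : UniqueDiffOn ℝ (strip T) :=
  uniqueDiffOn_univ.prod (uniqueDiffOn_Icc hT)

lemma strip_closure {T : ℝ} (hT : 0 < T) : strip T ⊆ closure (interior (strip T)) := by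
  unfold strip
  rw [interior_prod_eq, closure_prod_eq, interior_univ, closure_univ, interior_Icc,
    closure_Ioo hT.ne]

lemma mem_strip {T x t : ℝ} : (x, t) ∈ strip T ↔ t ∈ Set.Icc 0 T := by
  simp [strip]

lemma dd_contDiffOn {T : ℝ} (hT : 0 < T) (v : ℝ × ℝ) {f : ℝ × ℝ → ℝ}
    (hf : ContDiffOn ℝ (⊤ : ℕ∞) f (strip T)) : ContDiffOn ℝ (⊤ : ℕ∞) (dd T v f) (strip T) := by
  have h1 : ContDiffOn ℝ (⊤ : ℕ∞) (fderivWithin ℝ f (strip T)) (strip T) :=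
    hf.fderivWithin (strip_uniqueDiff hT) (by exact_mod_cast le_rfl)
  exact h1.clm_apply contDiffOn_const

lemma dd_comm {T : ℝ} (hT : 0 < T) (v w : ℝ × ℝ) {f : ℝ × ℝ → ℝ}
    (hf : ContDiffOn ℝ (⊤ : ℕ∞) f (strip T)) {p : ℝ × ℝ} (hp : p ∈ strip T) :
    dd T v (dd T w f) p = dd T w (dd T v f) p := by
  have h1 : ContDiffOn ℝ (⊤ : ℕ∞) (fderivWithin ℝ f (strip T)) (strip T) :=
    hf.fderivWithin (strip_uniqueDiff hT) (by exact_mod_cast le_rfl)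
  have hd : DifferentiableWithinAt ℝ (fderivWithin ℝ f (strip T)) (strip T) p :=
    (h1.differentiableOn (by simp)) p hp
  have key : ∀ a b : ℝ × ℝ, dd T a (dd T b f) p
      = fderivWithin ℝ (fderivWithin ℝ f (strip T)) (strip T) p a b := by
    intro a b
    have := hd.hasFDerivWithinAt.clm_apply (hasFDerivWithinAt_const b p (strip T))
    unfold dd
    have e := this.fderivWithin (strip_uniqueDiff hT p hp)
    rw [e]
    simp
  rw [key, key]
  have hs : IsSymmSndFDerivWithinAt ℝ f (strip T) p :=
    (hf p hp).isSymmSndFDerivWithinAt (by simp only [minSmoothness_of_isRCLikeNormedField]; exact WithTop.coe_le_coe.2 le_top)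
      (strip_uniqueDiff hT) (strip_closure hT hp) hp
  exact hs v w

lemma dd_hasDerivAt {T : ℝ} {f : ℝ × ℝ → ℝ}
    (hf : ContDiffOn ℝ (⊤ : ℕ∞) f (strip T)) {x t : ℝ} (ht : t ∈ Set.Icc 0 T) :
    HasDerivAt (fun y => f (y, t)) (dd T (1, 0) f (x, t)) x := by
  have h1 := ((hf.differentiableOn (by simp)) (x, t) (mem_strip.2 ht)).hasFDerivWithinAt
  have h2 : HasDerivWithinAt (fun y : ℝ => (y, t)) ((1:ℝ), (0:ℝ)) Set.univ x :=
    ((hasDerivAt_id x).prodMk (hasDerivAt_const x t)).hasDerivWithinAt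
  have := h1.comp_hasDerivWithinAt x h2 (fun y _ => mem_strip.2 ht)
  exact hasDerivWithinAt_univ.1 this

lemma dd_hasDerivWithinAt {T : ℝ} {f : ℝ × ℝ → ℝ}
    (hf : ContDiffOn ℝ (⊤ : ℕ∞) f (strip T)) {x t : ℝ} (ht : t ∈ Set.Icc 0 T) :
    HasDerivWithinAt (fun s => f (x, s)) (dd T (0, 1) f (x, t)) (Set.Icc 0 T) t := by
  have h1 := ((hf.differentiableOn (by simp)) (x, t) (mem_strip.2 ht)).hasFDerivWithinAt
  have h2 : HasDerivWithinAt (fun s : ℝ => (x, s)) ((0:ℝ), (1:ℝ)) (Set.Icc 0 T) t :=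
    ((hasDerivAt_const t x).prodMk (hasDerivAt_id t)).hasDerivWithinAt
  exact h1.comp_hasDerivWithinAt t h2 (fun y hy => mem_strip.2 hy)

lemma second_deriv_nonpos {φ φ' : ℝ → ℝ} {c x : ℝ} (h1 : ∀ y, HasDerivAt φ (φ' y) y)
    (h2 : HasDerivAt φ' c x) (hmax : ∀ y, φ y ≤ φ x) : c ≤ 0 := by
  by_contra hc
  push Not at hc
  have hd : deriv φ = φ' := funext fun y => (h1 y).deriv
  have hM : IsLocalMax φ x := Filter.Eventually.of_forall hmax
  have hm : IsLocalMin φ x := by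
    apply isLocalMin_of_deriv_deriv_pos
    · rw [hd, h2.deriv]; exact hc
    · exact hM.deriv_eq_zero
    · exact (h1 x).continuousAt
  have he : φ =ᶠ[nhds x] fun _ => φ x := by
    filter_upwards [hM, hm] with y a b using le_antisymm a b
  have h3 : deriv (deriv φ) x = deriv (deriv (fun _ => φ x)) x := he.deriv.deriv_eq
  rw [hd, h2.deriv] at h3
  simp at h3
  linarith

lemma left_deriv_nonneg {ψ : ℝ → ℝ} {c t T : ℝ} (ht0 : 0 < t) (htT : t ≤ T)
    (h1 : HasDerivWithinAt ψ c (Set.Icc 0 T) t)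
    (hmax : ∀ s ∈ Set.Icc 0 T, ψ s ≤ ψ t) : 0 ≤ c := by
  have hM : IsLocalMaxOn ψ (Set.Icc 0 T) t :=
    Filter.eventually_of_mem self_mem_nhdsWithin hmax
  have hseg : segment ℝ t 0 ⊆ Set.Icc 0 T :=
    (convex_Icc 0 T).segment_subset ⟨ht0.le, htT⟩ ⟨le_rfl, ht0.le.trans htT⟩
  have := hM.hasFDerivWithinAt_nonpos h1.hasFDerivWithinAt
    (sub_mem_posTangentConeAt_of_segment_subset hseg)
  simp at this
  nlinarith

/-- The pointwise maximum-principle computation. -/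
lemma tso_point {α r₀ T : ℝ} (hα : 0 < α) (hr₀ : 0 < r₀) (hT : 0 < T)
    {lam : ℝ → ℝ} (hlam : ∀ t ∈ Set.Icc (0:ℝ) T, 0 ≤ lam t) {f u : ℝ × ℝ → ℝ}
    (hf : ContDiffOn ℝ (⊤ : ℕ∞) f (strip T))
    (hu : u = fun p => f p + dd T (1, 0) (dd T (1, 0) f) p)
    (hpos : ∀ p ∈ strip T, 0 < u p)
    (hflow : ∀ x, ∀ t ∈ Set.Icc 0 T, dd T (0, 1) f (x, t) = - (u (x, t)) ^ (-α) + lam t)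
    {x t : ℝ} (ht : t ∈ Set.Icc 0 T) (ht0 : 0 < t) (hlow : r₀ < f (x, t)) {G : ℝ}
    (hG : (u (x, t)) ^ (-α) = G * (f (x, t) - r₀))
    (hGmax : ∀ y, ∀ s ∈ Set.Icc 0 T, (u (y, s)) ^ (-α) ≤ G * (f (y, s) - r₀)) :
    (u (x, t))⁻¹ ≤ (1 + 1 / α) / r₀ := by
  have hxx := dd_contDiffOn hT (1, 0) (dd_contDiffOn hT (1, 0) hf)
  have huc : ContDiffOn ℝ (⊤ : ℕ∞) u (strip T) := by
    rw [hu]; exact hf.add hxx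
  set F : ℝ × ℝ → ℝ := fun p => (u p) ^ (-α) with hF
  have hFc : ContDiffOn ℝ (⊤ : ℕ∞) F (strip T) :=
    huc.rpow_const_of_ne (fun p hp => (hpos p hp).ne')
  have hft := dd_contDiffOn hT (0, 1) hf
  have hfx := dd_contDiffOn hT (1, 0) hf
  have hFx := dd_contDiffOn hT (1, 0) hFc
  have hps : (x, t) ∈ strip T := mem_strip.2 ht
  -- spatial derivatives of the flow
  have e1 : ∀ y, ∀ s ∈ Set.Icc 0 T,
      dd T (1, 0) (dd T (0, 1) f) (y, s) = - dd T (1, 0) F (y, s) := by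
    intro y s hs
    have a := dd_hasDerivAt hft (x := y) hs
    have b := ((dd_hasDerivAt hFc (x := y) hs).neg).add_const (lam s)
    refine a.unique (b.congr_of_eventuallyEq (Filter.Eventually.of_forall fun z => ?_))
    exact hflow z s hs
  have e2 : dd T (1, 0) (dd T (1, 0) (dd T (0, 1) f)) (x, t)
      = - dd T (1, 0) (dd T (1, 0) F) (x, t) := by
    have a := dd_hasDerivAt (dd_contDiffOn hT (1, 0) hft) (x := x) ht
    have b := (dd_hasDerivAt hFx (x := x) ht).neg
    refine a.unique (b.congr_of_eventuallyEq (Filter.Eventually.of_forall fun z => ?_))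
    exact e1 z t ht
  -- commute
  have e3 : dd T (0, 1) (dd T (1, 0) (dd T (1, 0) f)) (x, t)
      = dd T (1, 0) (dd T (1, 0) (dd T (0, 1) f)) (x, t) := by
    rw [dd_comm hT (0, 1) (1, 0) hfx hps]
    have a := dd_hasDerivAt (dd_contDiffOn hT (0, 1) hfx) (x := x) ht
    have b := dd_hasDerivAt (dd_contDiffOn hT (1, 0) hft) (x := x) ht
    refine a.unique (b.congr_of_eventuallyEq (Filter.Eventually.of_forall fun z => ?_))
    exact dd_comm hT (0, 1) (1, 0) hf (mem_strip.2 ht)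
  -- time derivative of `u`
  have e4 : HasDerivWithinAt (fun s => u (x, s))
      (dd T (0, 1) f (x, t) - dd T (1, 0) (dd T (1, 0) F) (x, t)) (Set.Icc 0 T) t := by
    have := (dd_hasDerivWithinAt hf (x := x) ht).add (dd_hasDerivWithinAt hxx (x := x) ht)
    rw [e3, e2, ← sub_eq_add_neg] at this
    rw [hu]
    exact this
  have hup := hpos _ hps
  have e5 := e4.rpow_const (p := -α) (Or.inl hup.ne')
  have e6 := e5.sub (((dd_hasDerivWithinAt hf (x := x) ht).sub_const r₀).const_mul G)
  have i1 := left_deriv_nonneg ht0 ht.2 e6 (by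
    intro s hs
    have := hGmax x s hs
    simp only [Pi.sub_apply]
    linarith)
  have i2 : dd T (1, 0) (dd T (1, 0) F) (x, t) - G * dd T (1, 0) (dd T (1, 0) f) (x, t) ≤ 0 := by
    refine second_deriv_nonpos (φ := fun y => F (y, t) - G * (f (y, t) - r₀))
      (φ' := fun y => dd T (1, 0) F (y, t) - G * dd T (1, 0) f (y, t)) (x := x) ?_ ?_ ?_
    · intro y
      exact (dd_hasDerivAt hFc ht).sub (((dd_hasDerivAt hf ht).sub_const r₀).const_mul G)
    · exact (dd_hasDerivAt hFx ht).sub ((dd_hasDerivAt hfx ht).const_mul G)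
    · intro y
      have := hGmax y t ht
      simp only [hF]
      linarith
  have hl := hlam t ht
  have hfl := hflow x t ht
  have hu' : dd T (1, 0) (dd T (1, 0) f) (x, t) = u (x, t) - f (x, t) := by rw [hu]; ring
  rw [hu'] at i2
  rw [Real.rpow_sub_one hup.ne', hfl] at i1
  have hFp : 0 < (u (x, t)) ^ (-α) := Real.rpow_pos_of_pos hup _
  generalize u (x, t) ^ (-α) = Q at *
  generalize dd T (1, 0) (dd T (1, 0) F) (x, t) = A at *
  generalize f (x, t) = k at *
  generalize u (x, t) = w at *
  generalize lam t = l at *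
  have hGp : 0 < G := by
    by_contra hc
    push Not at hc
    nlinarith
  have j1 : 0 ≤ α * (Q / w) * (G * (w - r₀)) + G * Q := by
    have c : 0 < α * (Q / w) := by positivity
    have : α * (Q / w) * (Q - l + A) ≤ α * (Q / w) * (G * (w - r₀)) := by
      apply mul_le_mul_of_nonneg_left _ c.le
      nlinarith
    nlinarith
  have j2 : α * (Q / w) * (G * (w - r₀)) + G * Q = G * Q * (α + 1 - α * r₀ * w⁻¹) := by
    field_simp
    ring
  rw [j2] at j1
  have j3 := nonneg_of_mul_nonneg_right j1 (by positivity)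
  rw [le_div_iff₀ hr₀, show 1 + 1 / α = (α + 1) / α by field_simp, le_div_iff₀ hα]
  linarith

open Real MeasureTheory Filter

/-- Curvature of the curve with support function `h`. -/
noncomputable def curv (h : ℝ → ℝ → ℝ) (θ t : ℝ) : ℝ :=
  (h θ t + hpp h θ t)⁻¹

/-- The constant `M` of Tso's estimate: the maximum of `r₀^{-(α+1)}(1 + 1/α)^α` and the
initial maximum of `κ^α/(h − r₀)`. -/
noncomputable def TsoM (α r₀ : ℝ) (h : ℝ → ℝ → ℝ) : ℝ :=
  max (r₀ ^ (-(α + 1)) * (1 + 1/α) ^ α)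
    (⨆ θ' : ℝ, (curv h θ' 0) ^ α / (h θ' 0 - r₀))

/-- Tso's maximum-principle estimate: along `h_t = −(h + h_θθ)^{−α} + λ(t)` with
`λ ≥ 0` and `h ≥ 2r₀`, the quantity `κ^α/(h − r₀)` is bounded by
`M = max{r₀^{−(α+1)}(1+1/α)^α, max_{θ'} κ(θ',0)^α/(h(θ',0) − r₀)}`, whence
`κ ≤ M^{1/α}(sup h − r₀)^{1/α}`. -/
theorem tso_curvature_estimate
    (m : ℕ) (hm : 1 ≤ m) (α r₀ T : ℝ) (hα : 0 < α) (hr₀ : 0 < r₀) (hT : 0 < T)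
    (lam : ℝ → ℝ) (hlamc : ContinuousOn lam (Set.Icc 0 T))
    (hlam : ∀ t ∈ Set.Icc (0:ℝ) T, 0 ≤ lam t)
    (h : ℝ → ℝ → ℝ)
    (hsmooth : ContDiffOn ℝ (⊤ : ℕ∞) (Function.uncurry h) (Set.univ ×ˢ Set.Icc (0:ℝ) T))
    (hper : ∀ θ, ∀ t ∈ Set.Icc (0:ℝ) T, h (θ + 2 * m * π) t = h θ t)
    (hconv : ∀ θ, ∀ t ∈ Set.Icc (0:ℝ) T, 0 < h θ t + hpp h θ t)
    (hlow : ∀ θ, ∀ t ∈ Set.Icc (0:ℝ) T, 2 * r₀ ≤ h θ t)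
    (hflow : ∀ θ, ∀ t ∈ Set.Icc (0:ℝ) T,
      derivWithin (fun s => h θ s) (Set.Icc 0 T) t
        = -(h θ t + hpp h θ t) ^ (-α) + lam t) :
    ∀ θ, ∀ t ∈ Set.Icc (0:ℝ) T,
      (curv h θ t) ^ α / (h θ t - r₀) ≤ TsoM α r₀ h ∧
      curv h θ t ≤
        (TsoM α r₀ h) ^ (1/α) *
          ((⨆ θ' : ℝ, ⨆ t' : Set.Icc (0:ℝ) T, h θ' (t' : ℝ)) - r₀) ^ (1/α) := by
  set f : ℝ × ℝ → ℝ := Function.uncurry h with hfdef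
  have hf : ContDiffOn ℝ (⊤ : ℕ∞) f (strip T) := hsmooth
  have hfx := dd_contDiffOn hT (1, 0) hf
  have hfxx := dd_contDiffOn hT (1, 0) hfx
  -- identification of the second derivative
  have hpp_eq : ∀ x, ∀ t ∈ Set.Icc (0:ℝ) T,
      hpp h x t = dd T (1, 0) (dd T (1, 0) f) (x, t) := by
    intro x t ht
    unfold hpp
    rw [iteratedDeriv_succ, iteratedDeriv_one]
    have e : deriv (fun y => h y t) = fun y => dd T (1, 0) f (y, t) :=
      funext fun y => (dd_hasDerivAt hf ht).deriv
    rw [e]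
    exact (dd_hasDerivAt hfx ht).deriv
  obtain ⟨u, hu⟩ : ∃ u : ℝ × ℝ → ℝ, u = fun p => f p + dd T (1, 0) (dd T (1, 0) f) p := ⟨_, rfl⟩
  have hu_eq : ∀ x, ∀ t ∈ Set.Icc (0:ℝ) T, h x t + hpp h x t = u (x, t) := by
    intro x t ht
    rw [hu, hpp_eq x t ht]
    rfl
  have huc : ContDiffOn ℝ (⊤ : ℕ∞) u (strip T) := by
    rw [hu]; exact hf.add hfxx
  have hpos : ∀ p ∈ strip T, 0 < u p := by
    rintro ⟨x, t⟩ hp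
    have ht := mem_strip.1 hp
    rw [← hu_eq x t ht]
    exact hconv x t ht
  have hflow' : ∀ x, ∀ t ∈ Set.Icc 0 T,
      dd T (0, 1) f (x, t) = - (u (x, t)) ^ (-α) + lam t := by
    intro x t ht
    rw [← hu_eq x t ht, ← hflow x t ht]
    exact ((dd_hasDerivWithinAt hf ht).derivWithin (uniqueDiffOn_Icc hT t ht)).symm
  -- the quotient
  obtain ⟨G, hG⟩ : ∃ G : ℝ × ℝ → ℝ, G = fun p => (u p) ^ (-α) / (f p - r₀) := ⟨_, rfl⟩
  have hden : ∀ p ∈ strip T, r₀ ≤ f p - r₀ := by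
    rintro ⟨x, t⟩ hp
    have := hlow x t (mem_strip.1 hp)
    change r₀ ≤ h x t - r₀
    linarith
  have hGc : ContinuousOn G (strip T) := by
    rw [hG]
    refine ContinuousOn.div ?_ (hf.continuousOn.sub continuousOn_const) ?_
    · exact huc.continuousOn.rpow_const (fun p hp => Or.inl (hpos p hp).ne')
    · intro p hp
      have := hden p hp
      linarith
  have hG_eq : ∀ x, ∀ t ∈ Set.Icc (0:ℝ) T, (curv h x t) ^ α / (h x t - r₀) = G (x, t) := by
    intro x t ht
    have hp := hpos (x, t) (mem_strip.2 ht)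
    unfold curv
    rw [hu_eq x t ht, hG, Real.inv_rpow hp.le, ← Real.rpow_neg hp.le]
    rfl
  -- periodicity
  have hP : 0 < 2 * (m : ℝ) * π := by
    have : (1:ℝ) ≤ m := by exact_mod_cast hm
    have := Real.pi_pos
    positivity
  have hGper : ∀ t ∈ Set.Icc (0:ℝ) T,
      Function.Periodic (fun x => (G (x, t), h x t)) (2 * m * π) := by
    intro t ht x
    have e : (fun z => h (z + 2 * m * π) t) = fun z => h z t := funext fun z => hper z t ht
    have e2 : hpp h (x + 2 * m * π) t = hpp h x t := by
      unfold hpp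
      have := congrFun (iteratedDeriv_comp_add_const 2 (fun z => h z t) (2 * m * π)) x
      rw [← this, e]
    simp only
    rw [← hG_eq _ t ht, ← hG_eq _ t ht]
    unfold curv
    rw [e2, hper x t ht]
  -- compactness
  obtain ⟨K, hK⟩ : ∃ K : Set (ℝ × ℝ),
    K = Set.Icc (0:ℝ) (2 * m * π) ×ˢ Set.Icc (0:ℝ) T := ⟨_, rfl⟩
  have hKc : IsCompact K := by rw [hK]; exact isCompact_Icc.prod isCompact_Icc
  have hKs : K ⊆ strip T := by
    rw [hK]; exact Set.prod_mono (Set.subset_univ _) le_rfl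
  have hKn : K.Nonempty := ⟨(0, 0), by rw [hK]; exact ⟨⟨le_rfl, hP.le⟩, ⟨le_rfl, hT.le⟩⟩⟩
  have hred : ∀ x, ∀ t ∈ Set.Icc (0:ℝ) T, ∃ p ∈ K, G (x, t) = G p ∧ h x t = f p := by
    intro x t ht
    obtain ⟨y, hy, hxy⟩ := (hGper t ht).exists_mem_Ico₀ hP x
    refine ⟨(y, t), by rw [hK]; exact ⟨⟨hy.1, hy.2.le⟩, ht⟩, ?_, ?_⟩
    · exact congrArg Prod.fst hxy
    · exact congrArg Prod.snd hxy
  obtain ⟨⟨x₁, t₁⟩, hp₁, hmax₁⟩ := hKc.exists_isMaxOn hKn (hGc.mono hKs)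
  obtain ⟨p₂, hp₂, hmax₂⟩ := hKc.exists_isMaxOn hKn (hf.continuousOn.mono hKs)
  have hGmax : ∀ x, ∀ t ∈ Set.Icc (0:ℝ) T, G (x, t) ≤ G (x₁, t₁) := by
    intro x t ht
    obtain ⟨p, hp, hpe, -⟩ := hred x t ht
    rw [hpe]; exact hmax₁ hp
  have hhmax : ∀ x, ∀ t ∈ Set.Icc (0:ℝ) T, h x t ≤ f p₂ := by
    intro x t ht
    obtain ⟨p, hp, -, hpe⟩ := hred x t ht
    rw [hpe]; exact hmax₂ hp
  have ht₁ : t₁ ∈ Set.Icc (0:ℝ) T := mem_strip.1 (hKs hp₁)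
  have h0 : (0:ℝ) ∈ Set.Icc (0:ℝ) T := ⟨le_rfl, hT.le⟩
  -- the main bound
  have hmain : G (x₁, t₁) ≤ TsoM α r₀ h := by
    rcases eq_or_lt_of_le ht₁.1 with h00 | hpos₁
    · unfold TsoM
      refine le_max_of_le_right ?_
      rw [← h00, ← hG_eq x₁ 0 h0]
      refine le_ciSup (f := fun θ' => (curv h θ' 0) ^ α / (h θ' 0 - r₀)) ?_ x₁
      refine ⟨G (x₁, t₁), ?_⟩
      rintro _ ⟨y, rfl⟩
      simp only
      rw [hG_eq y 0 h0]
      exact hGmax y 0 h0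
    · unfold TsoM
      refine le_max_of_le_left ?_
      have hd₁ := hden (x₁, t₁) (hKs hp₁)
      have hu₁ := hpos (x₁, t₁) (hKs hp₁)
      have key := tso_point hα hr₀ hT hlam hf hu hpos hflow' ht₁ hpos₁
        (x := x₁) (G := G (x₁, t₁)) (by linarith)
        (by
          rw [hG]
          simp only
          rw [div_mul_cancel₀]
          linarith)
        (by
          intro y s hs
          have hd := hden (y, s) (mem_strip.2 hs)
          rw [← div_le_iff₀ (by linarith)]
          have := hGmax y s hs
          rw [hG] at this ⊢
          exact this)
      rw [hG]
      simp only
      rw [Real.rpow_neg hu₁.le, ← Real.inv_rpow hu₁.le]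
      have hc : 0 < 1 + 1 / α := by positivity
      have k1 : (u (x₁, t₁))⁻¹ ^ α ≤ ((1 + 1 / α) / r₀) ^ α :=
        Real.rpow_le_rpow (by positivity) key hα.le
      have k2 : r₀ ^ (-(α + 1)) * (1 + 1 / α) ^ α = ((1 + 1 / α) / r₀) ^ α / r₀ := by
        rw [Real.div_rpow hc.le hr₀.le, Real.rpow_neg hr₀.le, Real.rpow_add_one hr₀.ne']
        field_simp
      rw [k2]
      exact div_le_div₀ (by positivity) k1 hr₀ hd₁
  intro x t ht
  have hfirst : (curv h x t) ^ α / (h x t - r₀) ≤ TsoM α r₀ h := by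
    rw [hG_eq x t ht]
    exact (hGmax x t ht).trans hmain
  refine ⟨hfirst, ?_⟩
  have hκ : 0 < curv h x t := inv_pos.2 (hconv x t ht)
  have hd : 0 < h x t - r₀ := by have := hlow x t ht; linarith
  have hM0 : 0 ≤ TsoM α r₀ h := le_trans (by positivity) hfirst
  have hsup : h x t ≤ ⨆ θ' : ℝ, ⨆ t' : Set.Icc (0:ℝ) T, h θ' (t' : ℝ) := by
    haveI : Nonempty (Set.Icc (0:ℝ) T) := ⟨⟨0, h0⟩⟩
    have a : h x t ≤ ⨆ t' : Set.Icc (0:ℝ) T, h x (t' : ℝ) := by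
      refine le_ciSup (f := fun t' : Set.Icc (0:ℝ) T => h x (t' : ℝ)) ?_ ⟨t, ht⟩
      refine ⟨f p₂, ?_⟩
      rintro _ ⟨s, rfl⟩
      exact hhmax x s s.2
    refine a.trans (le_ciSup (f := fun θ' => ⨆ t' : Set.Icc (0:ℝ) T, h θ' (t' : ℝ)) ?_ x)
    refine ⟨f p₂, ?_⟩
    rintro _ ⟨y, rfl⟩
    exact ciSup_le fun s => hhmax y s s.2
  generalize (⨆ θ' : ℝ, ⨆ t' : Set.Icc (0:ℝ) T, h θ' (t' : ℝ)) = S at *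
  rw [← Real.mul_rpow hM0 (by linarith)]
  have hk : (curv h x t) ^ α ≤ TsoM α r₀ h * (S - r₀) := by
    rw [div_le_iff₀ hd] at hfirst
    exact hfirst.trans (mul_le_mul_of_nonneg_left (by linarith) hM0)
  calc curv h x t = ((curv h x t) ^ α) ^ (1 / α) := by
        rw [← Real.rpow_mul hκ.le, mul_one_div_cancel hα.ne', Real.rpow_one]
    _ ≤ _ := Real.rpow_le_rpow (by positivity) hk (by positivity)
end

section
/- Let m ≥ 1 be an integer, α > 0, p = 1 + 1/α, T > 0. Let v : ℝ × [0,T) → (0,∞) be a smooth function, 2mπ-periodic in θ, satisfying v_t = α v^p (v_θθ + v − λ(t)) with λ(t) = (1/(2mπ))∫₀^{2mπ} v(θ,t) dθ. Define the energy E(t) = ∫₀^{2mπ} (v_θ(θ,t))² dθ − ∫₀^{2mπ} (v(θ,t) − λ(t))² dθ. Then E is differentiable with dE/dt = −2 ∫₀^{2mπ} (v_t)² / (α v^p) dθ ≤ 0; in particular E is nonincreasing on [0,T). -/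
open Real MeasureTheory Filter

/-- Mean of `v(·,t)` over `[0,2mπ]`, the nonlocal term of the LP flow. -/
noncomputable def lamMean (m : ℕ) (v : ℝ → ℝ → ℝ) (t : ℝ) : ℝ :=
  (1 / (2 * m * π)) * ∫ θ in (0:ℝ)..(2 * m * π), v θ t

/-- The energy `E(t) = ∫₀^{2mπ} (v_θ)² dθ − ∫₀^{2mπ} (v − λ(t))² dθ`. -/
noncomputable def energy (m : ℕ) (v : ℝ → ℝ → ℝ) (t : ℝ) : ℝ :=
  (∫ θ in (0:ℝ)..(2 * m * π), (deriv (fun x => v x t) θ) ^ 2)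
    - ∫ θ in (0:ℝ)..(2 * m * π), (v θ t - lamMean m v t) ^ 2

/-- Differentiation under the integral sign, one-sided version. -/
lemma hasDerivWithinAt_integral_Ico {T L : ℝ} (g g' : ℝ × ℝ → ℝ)
    (hg : ContinuousOn g (Set.univ ×ˢ Set.Ico (0:ℝ) T))
    (hg' : ContinuousOn g' (Set.univ ×ˢ Set.Ico (0:ℝ) T))
    (hd : ∀ θ, ∀ t ∈ Set.Ico (0:ℝ) T,
      HasDerivWithinAt (fun s => g (θ, s)) (g' (θ, t)) (Set.Ico 0 T) t)
    (t : ℝ) (ht : t ∈ Set.Ico (0:ℝ) T) :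
    HasDerivWithinAt (fun s => ∫ θ in (0:ℝ)..L, g (θ, s))
      (∫ θ in (0:ℝ)..L, g' (θ, t)) (Set.Ico 0 T) t := by
  have hsl : ∀ s ∈ Set.Ico (0:ℝ) T, Continuous (fun θ => g (θ, s)) := by
    intro s hs
    rw [← continuousOn_univ]
    exact hg.comp (by fun_prop) (fun x _ => ⟨Set.mem_univ _, hs⟩)
  obtain ⟨b, htb, hbT⟩ := exists_between ht.2
  have hsub : Set.uIcc 0 L ×ˢ Set.Icc 0 b ⊆ Set.univ ×ˢ Set.Ico (0:ℝ) T := by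
    rintro ⟨x, y⟩ ⟨_, hy⟩
    exact ⟨Set.mem_univ _, hy.1, hy.2.trans_lt hbT⟩
  obtain ⟨C, hC⟩ := (isCompact_uIcc.prod isCompact_Icc).exists_bound_of_continuousOn
    (hg'.mono hsub)
  rw [hasDerivWithinAt_iff_tendsto_slope]
  have hev : ∀ᶠ s in nhdsWithin t (Set.Ico 0 T \ {t}), s ∈ Set.Ico (0:ℝ) T ∧ s ≠ t ∧ s < b := by
    filter_upwards [self_mem_nhdsWithin, mem_nhdsWithin_of_mem_nhds (Iio_mem_nhds htb)] with s h1 h2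
    exact ⟨h1.1, h1.2, h2⟩
  have key : Tendsto (fun s => ∫ θ in (0:ℝ)..L, slope (fun s => g (θ, s)) t s)
      (nhdsWithin t (Set.Ico 0 T \ {t})) (nhds (∫ θ in (0:ℝ)..L, g' (θ, t))) := by
    apply intervalIntegral.tendsto_integral_filter_of_dominated_convergence (fun _ => C)
    · filter_upwards [hev] with s hs
      apply Continuous.aestronglyMeasurable
      simp only [slope_def_field]
      exact ((hsl s hs.1).sub (hsl t ht)).div_const _
    · filter_upwards [hev] with s hs
      refine Eventually.of_forall fun θ hθ => ?_
      have := Convex.norm_image_sub_le_of_norm_hasDerivWithin_le (s := Set.Icc 0 b)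
        (f := fun s => g (θ, s)) (f' := fun s => g' (θ, s)) (C := C) (x := t) (y := s)
        (fun x hx => (hd θ x ⟨hx.1, hx.2.trans_lt hbT⟩).mono
          (fun y hy => ⟨hy.1, hy.2.trans_lt hbT⟩))
        (fun x hx => hC (θ, x) ⟨Set.uIoc_subset_uIcc hθ, hx⟩) (convex_Icc 0 b)
        ⟨ht.1, htb.le⟩ ⟨hs.1.1, hs.2.2.le⟩
      rw [slope_def_field, norm_div]
      exact div_le_of_le_mul₀ (norm_nonneg _) ((norm_nonneg _).trans
        (hC (θ, t) ⟨Set.uIoc_subset_uIcc hθ, ht.1, htb.le⟩)) this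
    · exact intervalIntegrable_const
    · refine Eventually.of_forall fun θ _ => ?_
      exact hasDerivWithinAt_iff_tendsto_slope.1 (hd θ t ht)
  refine key.congr' ?_
  filter_upwards [hev] with s hs
  simp only [slope_def_field]
  rw [intervalIntegral.integral_div, intervalIntegral.integral_sub]
  · exact (hsl s hs.1).intervalIntegrable _ _
  · exact (hsl t ht).intervalIntegrable _ _

/-- Partial derivatives of a function smooth on the strip. -/
lemma strip_partials {T : ℝ} (F : ℝ × ℝ → ℝ)
    (hF : ContDiffOn ℝ 1 F (Set.univ ×ˢ Set.Ico (0:ℝ) T))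
    (θ t : ℝ) (ht : t ∈ Set.Ico (0:ℝ) T) :
    HasDerivAt (fun x => F (x, t))
      (fderivWithin ℝ F (Set.univ ×ˢ Set.Ico (0:ℝ) T) (θ, t) (1, 0)) θ ∧
    HasDerivWithinAt (fun s => F (θ, s))
      (fderivWithin ℝ F (Set.univ ×ˢ Set.Ico (0:ℝ) T) (θ, t) (0, 1)) (Set.Ico 0 T) t := by
  have h := (hF.differentiableOn one_ne_zero (θ, t) ⟨Set.mem_univ _, ht⟩).hasFDerivWithinAt
  constructor
  · rw [← hasDerivWithinAt_univ]
    exact h.comp_hasDerivWithinAt (f := fun x : ℝ => (x, t)) θ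
      ((hasDerivWithinAt_id _ _).prodMk (hasDerivWithinAt_const _ _ _))
      (fun x _ => ⟨Set.mem_univ _, ht⟩)
  · exact h.comp_hasDerivWithinAt (f := fun x : ℝ => (θ, x)) t
      ((hasDerivWithinAt_const _ _ _).prodMk (hasDerivWithinAt_id _ _))
      (fun x hx => ⟨Set.mem_univ _, hx⟩)

/-- All the partial derivatives needed. -/
lemma strip_data {T : ℝ} (hT : 0 < T) (f : ℝ × ℝ → ℝ)
    (hf : ContDiffOn ℝ (⊤ : ℕ∞) f (Set.univ ×ˢ Set.Ico (0:ℝ) T)) :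
    ∃ a b c d : ℝ × ℝ → ℝ,
      ContinuousOn a (Set.univ ×ˢ Set.Ico (0:ℝ) T) ∧
      ContinuousOn b (Set.univ ×ˢ Set.Ico (0:ℝ) T) ∧
      ContinuousOn c (Set.univ ×ˢ Set.Ico (0:ℝ) T) ∧
      ContinuousOn d (Set.univ ×ˢ Set.Ico (0:ℝ) T) ∧
      ∀ θ, ∀ t ∈ Set.Ico (0:ℝ) T,
        HasDerivAt (fun x => f (x, t)) (a (θ, t)) θ ∧
        HasDerivWithinAt (fun s => f (θ, s)) (b (θ, t)) (Set.Ico 0 T) t ∧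
        HasDerivAt (fun x => a (x, t)) (c (θ, t)) θ ∧
        HasDerivWithinAt (fun s => a (θ, s)) (d (θ, t)) (Set.Ico 0 T) t ∧
        HasDerivAt (fun x => b (x, t)) (d (θ, t)) θ := by
  set S : Set (ℝ × ℝ) := Set.univ ×ˢ Set.Ico (0:ℝ) T with hS
  have hu : UniqueDiffOn ℝ S := uniqueDiffOn_univ.prod (uniqueDiffOn_Ico 0 T)
  have hD : ContDiffOn ℝ (⊤ : ℕ∞) (fderivWithin ℝ f S) S := hf.fderivWithin hu (by simp)
  have hDD : ContDiffOn ℝ (⊤ : ℕ∞) (fderivWithin ℝ (fderivWithin ℝ f S) S) S :=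
    hD.fderivWithin hu (by simp)
  have hle : (1 : WithTop ℕ∞) ≤ ((⊤ : ℕ∞) : WithTop ℕ∞) := by
    exact_mod_cast (le_top : (1 : ℕ∞) ≤ ⊤)
  have hle2 : (2 : WithTop ℕ∞) ≤ ((⊤ : ℕ∞) : WithTop ℕ∞) := by
    exact WithTop.coe_le_coe.2 (le_top : (2 : ℕ∞) ≤ ⊤)
  have hc : ∀ w, ContDiffOn ℝ (⊤ : ℕ∞) (fun p => fderivWithin ℝ f S p w) S :=
    fun w => hD.clm_apply contDiffOn_const
  have hcc : ∀ w z, ContinuousOn (fun p => fderivWithin ℝ (fderivWithin ℝ f S) S p w z) S :=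
    fun w z => ((hDD.clm_apply contDiffOn_const).clm_apply contDiffOn_const).continuousOn
  have happ : ∀ w z, ∀ p ∈ S, fderivWithin ℝ (fun p => fderivWithin ℝ f S p w) S p z
      = fderivWithin ℝ (fderivWithin ℝ f S) S p z w := by
    intro w z p hp
    have h := (hD.differentiableOn (by simp) p hp).hasFDerivWithinAt
    have h2 := (h.clm_apply (hasFDerivWithinAt_const w p S)).fderivWithin (hu p hp)
    rw [h2]
    simp
  refine ⟨fun p => fderivWithin ℝ f S p (1, 0), fun p => fderivWithin ℝ f S p (0, 1),
    fun p => fderivWithin ℝ (fderivWithin ℝ f S) S p (1, 0) (1, 0),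
    fun p => fderivWithin ℝ (fderivWithin ℝ f S) S p (0, 1) (1, 0),
    (hc _).continuousOn, (hc _).continuousOn, hcc _ _, hcc _ _, ?_⟩
  intro θ t ht
  have hp : (θ, t) ∈ S := ⟨Set.mem_univ _, ht⟩
  have h0 := strip_partials f (hf.of_le hle) θ t ht
  have h1 := strip_partials _ ((hc (1, 0)).of_le hle) θ t ht
  have h2 := strip_partials _ ((hc (0, 1)).of_le hle) θ t ht
  rw [← hS] at h0 h1 h2
  rw [happ _ _ _ hp, happ _ _ _ hp] at h1 h2
  have hcl : (θ, t) ∈ closure (interior S) := by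
    rw [hS, interior_prod_eq, closure_prod_eq, interior_univ, closure_univ, interior_Ico,
      closure_Ioo hT.ne]
    exact ⟨Set.mem_univ _, ht.1, ht.2.le⟩
  have hsym := (hf (θ, t) hp).isSymmSndFDerivWithinAt (by simpa using hle2) hu hcl hp
  rw [hsym.eq (1, 0) (0, 1)] at h2
  exact ⟨h0.1, h0.2, h1.1, h1.2, h2.1⟩

/-- Along `v_t = α v^p (v_θθ + v − λ(t))` with `p = 1 + 1/α` and `λ(t)` the mean of
`v(·,t)`, the energy `E(t)` is differentiable with
`E'(t) = −2∫ (v_t)²/(α v^p) dθ ≤ 0`; in particular `E` is nonincreasing. -/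
theorem lp_energy_monotone
    (m : ℕ) (hm : 1 ≤ m) (α T : ℝ) (hα : 0 < α) (hT : 0 < T)
    (v : ℝ → ℝ → ℝ)
    (hpos : ∀ θ, ∀ t ∈ Set.Ico (0:ℝ) T, 0 < v θ t)
    (hsmooth : ContDiffOn ℝ (⊤ : ℕ∞) (Function.uncurry v) (Set.univ ×ˢ Set.Ico (0:ℝ) T))
    (hper : ∀ θ, ∀ t ∈ Set.Ico (0:ℝ) T, v (θ + 2 * m * π) t = v θ t)
    (hflow : ∀ θ, ∀ t ∈ Set.Ico (0:ℝ) T,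
      derivWithin (fun s => v θ s) (Set.Ico 0 T) t
        = α * v θ t ^ (1 + 1/α) *
          (iteratedDeriv 2 (fun x => v x t) θ + v θ t - lamMean m v t)) :
    (∀ t ∈ Set.Ico (0:ℝ) T,
      HasDerivWithinAt (energy m v)
        (-2 * ∫ θ in (0:ℝ)..(2 * m * π),
            (derivWithin (fun s => v θ s) (Set.Ico 0 T) t) ^ 2
              / (α * v θ t ^ (1 + 1/α)))
        (Set.Ico 0 T) t ∧
      -2 * (∫ θ in (0:ℝ)..(2 * m * π),
            (derivWithin (fun s => v θ s) (Set.Ico 0 T) t) ^ 2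
              / (α * v θ t ^ (1 + 1/α))) ≤ 0) ∧
    AntitoneOn (energy m v) (Set.Ico 0 T) := by
  have main : ∀ t ∈ Set.Ico (0:ℝ) T,
      HasDerivWithinAt (energy m v)
        (-2 * ∫ θ in (0:ℝ)..(2 * m * π),
            (derivWithin (fun s => v θ s) (Set.Ico 0 T) t) ^ 2
              / (α * v θ t ^ (1 + 1/α)))
        (Set.Ico 0 T) t := by
    obtain ⟨a, b, c, d, ha, hb, hc, hd, hall⟩ := strip_data hT (Function.uncurry v) hsmooth
    simp only [Function.uncurry_apply_pair] at hall
    have hf := hsmooth.continuousOn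
    have hLpos : (0:ℝ) < 2 * m * π := by
      have : (0:ℝ) < m := by exact_mod_cast hm
      positivity
    set L : ℝ := 2 * m * π with hL
    have sl : ∀ F : ℝ × ℝ → ℝ, ContinuousOn F (Set.univ ×ˢ Set.Ico (0:ℝ) T) →
        ∀ s ∈ Set.Ico (0:ℝ) T, Continuous (fun θ => F (θ, s)) := by
      intro F hF s hs
      rw [← continuousOn_univ]
      exact hF.comp (by fun_prop) (fun x _ => ⟨Set.mem_univ _, hs⟩)
    have hlamL : ∀ s, ∫ θ in (0:ℝ)..L, v θ s = L * lamMean m v s := by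
      intro s
      rw [lamMean, ← hL]
      field_simp
    -- the energy in expanded form
    have hE : ∀ s ∈ Set.Ico (0:ℝ) T, energy m v s =
        (∫ θ in (0:ℝ)..L, (a (θ, s)) ^ 2) - ((∫ θ in (0:ℝ)..L, (v θ s) ^ 2)
          - L * lamMean m v s ^ 2) := by
      intro s hs
      have hv : Continuous (fun θ => v θ s) := sl _ hf s hs
      rw [energy, ← hL]
      congr 1
      · congr 1
        ext θ
        rw [(hall θ s hs).1.deriv]
      · have : ∀ θ, (v θ s - lamMean m v s) ^ 2
            = (v θ s ^ 2 - 2 * lamMean m v s * v θ s) + lamMean m v s ^ 2 := fun θ => by ring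
        simp only [this]
        rw [intervalIntegral.integral_add
            (Continuous.intervalIntegrable (by fun_prop) _ _) intervalIntegrable_const,
          intervalIntegral.integral_sub (Continuous.intervalIntegrable (by fun_prop) _ _)
            (Continuous.intervalIntegrable (by fun_prop) _ _),
          intervalIntegral.integral_const_mul, intervalIntegral.integral_const, hlamL]
        simp only [smul_eq_mul]
        ring
    intro t ht
    have hv : Continuous (fun θ => v θ t) := sl _ hf t ht
    have hat := sl a ha t ht
    have hbt := sl b hb t ht
    have hct := sl c hc t ht
    have hdt := sl d hd t ht
    have D1 := hasDerivWithinAt_integral_Ico (L := L) (fun p => a p ^ 2)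
      (fun p => 2 * (a p * d p)) (ha.pow 2) (continuousOn_const.mul (ha.mul hd))
      (fun θ s hs => by
        refine ((hall θ s hs).2.2.2.1.pow 2).congr_deriv ?_
        simp
        ring) t ht
    have D2 := hasDerivWithinAt_integral_Ico (L := L) (fun p => Function.uncurry v p ^ 2)
      (fun p => 2 * (Function.uncurry v p * b p)) (hf.pow 2) (continuousOn_const.mul (hf.mul hb))
      (fun θ s hs => by
        refine ((hall θ s hs).2.1.pow 2).congr_deriv ?_
        simp
        ring) t ht
    have D3 := hasDerivWithinAt_integral_Ico (L := L) (Function.uncurry v) b hf hb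
      (fun θ s hs => (hall θ s hs).2.1) t ht
    simp only [Function.uncurry_apply_pair] at D2 D3
    have D4 : HasDerivWithinAt (lamMean m v) (1 / L * ∫ θ in (0:ℝ)..L, b (θ, t))
        (Set.Ico 0 T) t := D3.const_mul (1 / L)
    have D5 := D1.sub (D2.sub ((D4.pow 2).const_mul L))
    have D6 := D5.congr_of_mem (f₁ := energy m v) (fun s hs => by simpa using hE s hs) ht
    refine D6.congr_deriv (Eq.symm ?_)
    -- periodicity
    have pa : a (L, t) = a (0, t) := by
      have h1 := (hall (0 + L) t ht).1.comp_add_const 0 L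
      have h2 : (fun x => v (x + L) t) = fun x => v x t := funext fun x => hper x t ht
      rw [h2] at h1
      simpa using h1.unique (hall 0 t ht).1
    have pb : b (L, t) = b (0, t) := by
      have h1 := (hall (0 + L) t ht).2.1
      have h2 := h1.congr_of_mem (f₁ := fun s => v 0 s) (fun s hs => (hper 0 s hs).symm) ht
      simpa using (uniqueDiffOn_Ico 0 T t ht).eq_deriv _ h2 (hall 0 t ht).2.1
    have ibp : ∫ θ in (0:ℝ)..L, a (θ, t) * d (θ, t)
        = - ∫ θ in (0:ℝ)..L, c (θ, t) * b (θ, t) := by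
      rw [intervalIntegral.integral_mul_deriv_eq_deriv_mul
        (u := fun θ => a (θ, t)) (v := fun θ => b (θ, t))
        (u' := fun θ => c (θ, t)) (v' := fun θ => d (θ, t))
        (fun x _ => (hall x t ht).2.2.1) (fun x _ => (hall x t ht).2.2.2.2)
        (hct.intervalIntegrable _ _) (hdt.intervalIntegrable _ _), pa, pb]
      ring
    have hint : ∀ θ, (derivWithin (fun s => v θ s) (Set.Ico 0 T) t) ^ 2
              / (α * v θ t ^ (1 + 1/α))
        = (c (θ, t) * b (θ, t) + v θ t * b (θ, t)) - lamMean m v t * b (θ, t) := by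
      intro θ
      have h1 : derivWithin (fun s => v θ s) (Set.Ico 0 T) t = b (θ, t) :=
        (hall θ t ht).2.1.derivWithin (uniqueDiffOn_Ico 0 T t ht)
      have h2 : iteratedDeriv 2 (fun x => v x t) θ = c (θ, t) := by
        rw [iteratedDeriv_succ, iteratedDeriv_one]
        have : deriv (fun x => v x t) = fun x => a (x, t) :=
          funext fun x => (hall x t ht).1.deriv
        rw [this, (hall θ t ht).2.2.1.deriv]
      have h3 := hflow θ t ht
      rw [h1, h2] at h3
      have h4 : 0 < v θ t ^ (1 + 1/α) := Real.rpow_pos_of_pos (hpos θ t ht) _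
      rw [h1, div_eq_iff (by positivity), pow_two]
      nth_rewrite 1 [h3]
      ring
    simp only [hint]
    rw [intervalIntegral.integral_sub (Continuous.intervalIntegrable (by exact (hct.mul hbt).add (hv.mul hbt)) _ _)
        (Continuous.intervalIntegrable (by exact continuous_const.mul hbt) _ _),
      intervalIntegral.integral_add (Continuous.intervalIntegrable (by exact hct.mul hbt) _ _)
        (Continuous.intervalIntegrable (by exact hv.mul hbt) _ _),
      intervalIntegral.integral_const_mul, intervalIntegral.integral_const_mul,
      intervalIntegral.integral_const_mul, ibp]
    field_simp
    ring
  have nonpos : ∀ t ∈ Set.Ico (0:ℝ) T, -2 * (∫ θ in (0:ℝ)..(2 * m * π),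
            (derivWithin (fun s => v θ s) (Set.Ico 0 T) t) ^ 2
              / (α * v θ t ^ (1 + 1/α))) ≤ 0 := by
    intro t ht
    have : 0 ≤ ∫ θ in (0:ℝ)..(2 * m * π),
            (derivWithin (fun s => v θ s) (Set.Ico 0 T) t) ^ 2
              / (α * v θ t ^ (1 + 1/α)) := by
      apply intervalIntegral.integral_nonneg (by positivity)
      intro θ _
      have h4 : 0 < v θ t ^ (1 + 1/α) := Real.rpow_pos_of_pos (hpos θ t ht) _
      positivity
    linarith
  refine ⟨fun t ht => ⟨main t ht, nonpos t ht⟩, ?_⟩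
  exact antitoneOn_of_hasDerivWithinAt_nonpos (convex_Ico 0 T)
    (fun t ht => (main t ht).continuousWithinAt)
    (fun t ht => (main t (interior_subset ht)).mono interior_subset)
    (fun t ht => nonpos t (interior_subset ht))
end

section
/- Let m ≥ 1 be an integer, α > 1, p = 1 + 1/α (so 0 < 2 − p < 1), T > 0. Let v : ℝ × [0,T) → (0,∞) be a smooth function, 2mπ-periodic in θ, satisfying v_t = α v^p (v_θθ + v − λ(t)) with λ(t) = (1/(2mπ))∫₀^{2mπ} v(θ,t) dθ. Then (d/dt) ∫₀^{2mπ} v(θ,t)^{2−p} dθ = −α(2−p)·E(t), where E(t) = ∫₀^{2mπ} (v_θ)² dθ − ∫₀^{2mπ} (v − λ(t))² dθ. In particular, if E(t) ≥ 0 for all t ∈ [0,T), then the quantity ∫₀^{2mπ} v^{2−p} dθ is nonincreasing in t. -/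
open Real MeasureTheory Filter

open Topology in
/-- Differentiation under the integral sign, one-sided at the boundary. -/
lemma hasDerivWithinAt_integral_aux (L T : ℝ) (hL : 0 ≤ L) (W : ℝ × ℝ → ℝ)
    (hW : ContDiffOn ℝ 1 W (Set.univ ×ˢ Set.Ico (0:ℝ) T)) (g : ℝ → ℝ → ℝ)
    (hg : ∀ θ, ∀ t ∈ Set.Ico (0:ℝ) T,
      HasDerivWithinAt (fun s => W (θ, s)) (g θ t) (Set.Ico 0 T) t)
    (t : ℝ) (ht : t ∈ Set.Ico (0:ℝ) T) :
    HasDerivWithinAt (fun s => ∫ θ in (0:ℝ)..L, W (θ, s)) (∫ θ in (0:ℝ)..L, g θ t)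
      (Set.Ico 0 T) t := by
  have hT : 0 < T := ht.1.trans_lt ht.2
  have hu1 : UniqueDiffOn ℝ (Set.Ico (0:ℝ) T) := uniqueDiffOn_Ico 0 T
  have hu : UniqueDiffOn ℝ (Set.univ ×ˢ Set.Ico (0:ℝ) T : Set (ℝ × ℝ)) :=
    uniqueDiffOn_univ.prod hu1
  have hcf := hW.continuousOn_fderivWithin hu le_rfl
  have hgeq : ∀ θ, ∀ s ∈ Set.Ico (0:ℝ) T,
      g θ s = fderivWithin ℝ W (Set.univ ×ˢ Set.Ico (0:ℝ) T) (θ, s) (0, 1) := by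
    intro θ s hs
    have h1 : HasFDerivWithinAt W (fderivWithin ℝ W (Set.univ ×ˢ Set.Ico (0:ℝ) T) (θ, s))
        (Set.univ ×ˢ Set.Ico (0:ℝ) T) (θ, s) :=
      (hW.differentiableOn one_ne_zero (θ, s) ⟨trivial, hs⟩).hasFDerivWithinAt
    have h2 : HasDerivWithinAt (fun s : ℝ => ((θ, s) : ℝ × ℝ)) (0, 1) (Set.Ico 0 T) s :=
      (hasDerivWithinAt_const s _ θ).prodMk (hasDerivWithinAt_id s _)
    have h3 := h1.comp_hasDerivWithinAt s h2 (fun x hx => ⟨trivial, hx⟩)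
    exact (hu1 s hs).eq_deriv _ (hg θ s hs) h3
  obtain ⟨t', htt', ht'T⟩ := exists_between ht.2
  have hK : IsCompact (Set.Icc (0:ℝ) L ×ˢ Set.Icc (0:ℝ) t') := isCompact_Icc.prod isCompact_Icc
  have hsub : Set.Icc (0:ℝ) L ×ˢ Set.Icc (0:ℝ) t' ⊆ Set.univ ×ˢ Set.Ico (0:ℝ) T :=
    fun x hx => ⟨trivial, hx.2.1, hx.2.2.trans_lt ht'T⟩
  have hcont : ContinuousOn (fun x : ℝ × ℝ =>
      fderivWithin ℝ W (Set.univ ×ˢ Set.Ico (0:ℝ) T) x (0, 1)) (Set.univ ×ˢ Set.Ico (0:ℝ) T) :=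
    hcf.clm_apply continuousOn_const
  obtain ⟨C, hC⟩ := hK.exists_bound_of_continuousOn (hcont.mono hsub)
  have hWc : ∀ s ∈ Set.Ico (0:ℝ) T, Continuous (fun θ => W (θ, s)) := by
    intro s hs
    exact hW.continuousOn.comp_continuous (by fun_prop) (fun θ => ⟨trivial, hs⟩)
  rw [hasDerivWithinAt_iff_tendsto_slope]
  have hev : ∀ᶠ s in 𝓝[Set.Ico (0:ℝ) T \ {t}] t, s ∈ Set.Ico (0:ℝ) T ∧ s ≤ t' ∧ s ≠ t := by
    have h1 : ∀ᶠ s in 𝓝[Set.Ico (0:ℝ) T \ {t}] t, s ∈ Set.Ico (0:ℝ) T \ {t} :=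
      eventually_mem_nhdsWithin
    have h2 : ∀ᶠ s in 𝓝[Set.Ico (0:ℝ) T \ {t}] t, s < t' :=
      nhdsWithin_le_nhds (Iio_mem_nhds htt')
    filter_upwards [h1, h2] with s h1 h2
    exact ⟨h1.1, h2.le, h1.2⟩
  have key : Tendsto (fun s => ∫ θ in (0:ℝ)..L, slope (fun s => W (θ, s)) t s)
      (𝓝[Set.Ico (0:ℝ) T \ {t}] t) (𝓝 (∫ θ in (0:ℝ)..L, g θ t)) := by
    apply intervalIntegral.tendsto_integral_filter_of_dominated_convergence (fun _ => C)
    · filter_upwards [hev] with s hs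
      apply Continuous.aestronglyMeasurable
      simp only [slope_def_field]
      exact ((hWc s hs.1).sub (hWc t ht)).div_const _
    · filter_upwards [hev] with s hs
      refine ae_of_all _ fun θ hθ => ?_
      rw [Set.uIoc_of_le hL] at hθ
      have hmv := Convex.norm_image_sub_le_of_norm_hasDerivWithin_le
        (f := fun s => W (θ, s)) (f' := g θ) (C := C) (s := Set.Icc (0:ℝ) t') (x := t) (y := s)
        (fun x hx => (hg θ x ⟨hx.1, hx.2.trans_lt ht'T⟩).mono
          (fun y hy => ⟨hy.1, hy.2.trans_lt ht'T⟩))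
        (fun x hx => by
          rw [hgeq θ x ⟨hx.1, hx.2.trans_lt ht'T⟩]
          exact hC (θ, x) ⟨⟨hθ.1.le, hθ.2⟩, hx⟩)
        (convex_Icc 0 t') ⟨ht.1, htt'.le⟩ ⟨hs.1.1, hs.2.1⟩
      have hne : 0 < ‖s - t‖ := norm_pos_iff.2 (sub_ne_zero.2 hs.2.2)
      rw [slope_def_field, norm_div, div_le_iff₀ hne]
      exact hmv
    · exact intervalIntegrable_const
    · exact ae_of_all _ fun θ _ => hasDerivWithinAt_iff_tendsto_slope.1 (hg θ t ht)
  refine key.congr' ?_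
  filter_upwards [hev] with s hs
  simp only [slope_def_field]
  rw [intervalIntegral.integral_div, intervalIntegral.integral_sub]
  · exact (hWc s hs.1).intervalIntegrable _ _
  · exact (hWc t ht).intervalIntegrable _ _

/-- Integration by parts and the mean property. -/
lemma energy_identity_aux (m : ℕ) (hm : 1 ≤ m) (v : ℝ → ℝ → ℝ) (t : ℝ)
    (hs : ContDiff ℝ 2 (fun x => v x t))
    (hper : ∀ θ, v (θ + 2 * m * π) t = v θ t) :
    ∫ θ in (0:ℝ)..(2 * m * π), v θ t *
      (iteratedDeriv 2 (fun x => v x t) θ + v θ t - lamMean m v t) = - energy m v t := by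
  have hLpos : (0:ℝ) < 2 * m * π := by
    have : (0:ℝ) < m := by exact_mod_cast hm
    positivity
  have hmean : ∫ θ in (0:ℝ)..(2 * m * π), v θ t = lamMean m v t * (2 * m * π) := by
    unfold lamMean
    field_simp
  unfold energy
  set L : ℝ := 2 * m * π with hLdef
  set f : ℝ → ℝ := fun x => v x t with hf
  set l := lamMean m v t
  have hfv : ∀ θ, v θ t = f θ := fun _ => rfl
  simp only [hfv] at *
  have hfc : Continuous f := hs.continuous
  have hd1 : ContDiff ℝ 1 (deriv f) := by
    have : ContDiff ℝ (1 + 1) f := by simpa [one_add_one_eq_two] using hs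
    exact (contDiff_succ_iff_deriv.1 this).2.2
  have hd1c : Continuous (deriv f) := hd1.continuous
  have hd2c : Continuous (deriv (deriv f)) := hd1.continuous_deriv le_rfl
  have hi2 : iteratedDeriv 2 f = deriv (deriv f) := by
    rw [iteratedDeriv_succ, iteratedDeriv_one]
  rw [hi2]
  have hperd : deriv f L = deriv f 0 := by
    have h : (fun x => f (x + L)) = f := funext hper
    have := deriv_comp_add_const f L 0
    rw [h, zero_add] at this
    exact this.symm
  have hper0 : f L = f 0 := by simpa using hper 0
  have hparts := intervalIntegral.integral_mul_deriv_eq_deriv_mul (a := 0) (b := L)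
    (u := f) (v := deriv f) (u' := deriv f) (v' := deriv (deriv f))
    (fun x _ => (hs.differentiable two_ne_zero x).hasDerivAt)
    (fun x _ => (hd1.differentiable one_ne_zero x).hasDerivAt)
    (hd1c.intervalIntegrable _ _) (hd2c.intervalIntegrable _ _)
  rw [hperd, hper0, sub_self, zero_sub] at hparts
  have e1 : ∫ θ in (0:ℝ)..L, f θ * (deriv (deriv f) θ + f θ - l)
      = (∫ θ in (0:ℝ)..L, f θ * deriv (deriv f) θ) + (∫ θ in (0:ℝ)..L, (f θ - l) ^ 2)
        + l * ∫ θ in (0:ℝ)..L, (f θ - l) := by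
    rw [← intervalIntegral.integral_const_mul, ← intervalIntegral.integral_add,
      ← intervalIntegral.integral_add]
    · congr 1; ext θ; ring
    all_goals exact Continuous.intervalIntegrable (by fun_prop) _ _
  have e2 : ∫ θ in (0:ℝ)..L, (f θ - l) = 0 := by
    rw [intervalIntegral.integral_sub (hfc.intervalIntegrable _ _) intervalIntegrable_const, hmean]
    simp
    ring
  rw [e1, e2, hparts]
  simp only [pow_two]
  ring

/-- For `α > 1`, `p = 1 + 1/α`, along `v_t = α v^p (v_θθ + v − λ(t))` with `λ(t)` the
mean of `v(·,t)`, one has `(d/dt)∫ v^{2−p} dθ = −α(2−p)E(t)`; in particular, if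
`E(t) ≥ 0` for all `t`, then `∫ v^{2−p} dθ` is nonincreasing. -/
theorem lp_power_integral_derivative
    (m : ℕ) (hm : 1 ≤ m) (α T : ℝ) (hα : 1 < α) (hT : 0 < T)
    (v : ℝ → ℝ → ℝ)
    (hpos : ∀ θ, ∀ t ∈ Set.Ico (0:ℝ) T, 0 < v θ t)
    (hsmooth : ContDiffOn ℝ (⊤ : ℕ∞) (Function.uncurry v) (Set.univ ×ˢ Set.Ico (0:ℝ) T))
    (hper : ∀ θ, ∀ t ∈ Set.Ico (0:ℝ) T, v (θ + 2 * m * π) t = v θ t)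
    (hflow : ∀ θ, ∀ t ∈ Set.Ico (0:ℝ) T,
      derivWithin (fun s => v θ s) (Set.Ico 0 T) t
        = α * v θ t ^ (1 + 1/α) *
          (iteratedDeriv 2 (fun x => v x t) θ + v θ t - lamMean m v t)) :
    (∀ t ∈ Set.Ico (0:ℝ) T,
      HasDerivWithinAt
        (fun s => ∫ θ in (0:ℝ)..(2 * m * π), v θ s ^ (2 - (1 + 1/α)))
        (-(α * (2 - (1 + 1/α))) * energy m v t)
        (Set.Ico 0 T) t) ∧
    ((∀ t ∈ Set.Ico (0:ℝ) T, 0 ≤ energy m v t) →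
      AntitoneOn (fun s => ∫ θ in (0:ℝ)..(2 * m * π), v θ s ^ (2 - (1 + 1/α)))
        (Set.Ico 0 T)) := by
  have main : ∀ t ∈ Set.Ico (0:ℝ) T,
      HasDerivWithinAt
        (fun s => ∫ θ in (0:ℝ)..(2 * m * π), v θ s ^ (2 - (1 + 1/α)))
        (-(α * (2 - (1 + 1/α))) * energy m v t)
        (Set.Ico 0 T) t := by
    intro t ht
    have hW : ContDiffOn ℝ 1 (fun x : ℝ × ℝ => v x.1 x.2 ^ (2 - (1 + 1/α)))
        (Set.univ ×ˢ Set.Ico (0:ℝ) T) := by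
      have h1 : ContDiffOn ℝ 1 (fun x : ℝ × ℝ => v x.1 x.2) (Set.univ ×ˢ Set.Ico (0:ℝ) T) :=
        hsmooth.of_le (by exact_mod_cast le_top)
      exact h1.rpow_const_of_ne (fun x hx => (hpos x.1 x.2 hx.2).ne')
    have hx : ContDiff ℝ 2 (fun x => v x t) := by
      have h1 : ContDiffOn ℝ 2 (Function.uncurry v) (Set.univ ×ˢ Set.Ico (0:ℝ) T) :=
        hsmooth.of_le (WithTop.coe_le_coe.2 (le_top : (2 : ℕ∞) ≤ ⊤))
      have h2 : ContDiff ℝ 2 (fun x : ℝ => (x, t)) := by fun_prop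
      have h3 := h1.comp (s := Set.univ) h2.contDiffOn (fun x _ => ⟨trivial, ht⟩)
      exact contDiffOn_univ.1 h3
    have hg : ∀ θ, ∀ s ∈ Set.Ico (0:ℝ) T,
        HasDerivWithinAt (fun s => v θ s ^ (2 - (1 + 1/α)))
          ((α * (2 - (1 + 1/α))) * (v θ s *
            (iteratedDeriv 2 (fun x => v x s) θ + v θ s - lamMean m v s)))
          (Set.Ico 0 T) s := by
      intro θ s hs
      have hd : DifferentiableWithinAt ℝ (fun s => v θ s) (Set.Ico 0 T) s := by
        have h1 := hsmooth.differentiableOn (by simp) (θ, s) ⟨trivial, hs⟩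
        have h2 : DifferentiableWithinAt ℝ (fun s : ℝ => ((θ, s) : ℝ × ℝ)) (Set.Ico 0 T) s := by
          fun_prop
        exact DifferentiableWithinAt.comp (g := Function.uncurry v) (f := fun s : ℝ => ((θ, s) : ℝ × ℝ)) s h1 h2 (fun x hx => ⟨trivial, hx⟩)
      have h := hd.hasDerivWithinAt
      rw [hflow θ s hs] at h
      have hp := hpos θ s hs
      have h' := h.rpow_const (p := 2 - (1 + 1/α)) (Or.inl hp.ne')
      convert h' using 1
      have : v θ s = v θ s ^ (1 + 1/α) * v θ s ^ (2 - (1 + 1/α) - 1) := by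
        rw [← Real.rpow_add hp]
        ring_nf
        simp
      conv_lhs => rw [show ∀ a b c : ℝ, a * (b * c) = a * c * b from fun a b c => by ring]
      conv_lhs => rhs; rw [this]
      ring
    have hL : (0:ℝ) ≤ 2 * m * π := by positivity
    have := hasDerivWithinAt_integral_aux (2 * m * π) T hL _ hW _ hg t ht
    rw [intervalIntegral.integral_const_mul,
      energy_identity_aux m hm v t hx (fun θ => hper θ t ht)] at this
    convert this using 1
    ring
  refine ⟨main, fun hE => ?_⟩
  have hc : 0 ≤ α * (2 - (1 + 1/α)) := by
    have : 1 / α < 1 := by rw [div_lt_one (by linarith)]; exact hα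
    apply mul_nonneg <;> linarith
  refine antitoneOn_of_hasDerivWithinAt_nonpos (f' := fun t => -(α * (2 - (1 + 1/α))) * energy m v t)
    (convex_Ico 0 T)
    (fun t ht => (main t ht).continuousWithinAt)
    (fun t ht => (main t (interior_subset ht)).mono interior_subset) (fun t ht => ?_)
  have := mul_nonneg hc (hE t (interior_subset ht))
  linarith
end
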